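/- Let 1 < p < p₁ ≤ ∞ and θ ∈ (0,1) with 1/p = (1-θ) + θ/p₁. Then the real interpolation space [H¹(μ), L^{p₁}(μ)]_{θ,p} equals L^p(μ) with equivalent norms. -/

import Mathlib

open scoped ENNReal NNReal
open MeasureTheory Filter

/-- An infinite homogeneous tree of order `q+1`: a connected acyclic graph in which
every vertex has exactly `q+1` neighbours, equipped with a doubly-infinite geodesic
`geo : ℤ → V` (the labelling `N` is the inverse of `geo`) and the associated level
function `lev`, satisfying `lev (geo i) = i`, changing by `±1` along edges, and such
that every vertex has exactly one neighbour lying directly above it. -/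
structure HomTree (q : ℕ) where
  V : Type
  G : SimpleGraph V
  conn : G.Connected
  acyclic : G.IsAcyclic
  degree : ∀ v : V, (G.neighborSet v).ncard = q + 1
  lev : V → ℤ
  geo : ℤ → V
  geo_dist : ∀ i j : ℤ, G.dist (geo i) (geo j) = (i - j).natAbs
  lev_geo : ∀ i : ℤ, lev (geo i) = i
  lev_adj : ∀ v w : V, G.Adj v w → lev w = lev v + 1 ∨ lev w = lev v - 1
  unique_above : ∀ v : V, ∃! w : V, G.Adj v w ∧ lev w = lev v + 1

namespace HomTree

variable {q : ℕ}

/-- Graph distance on the tree. -/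
noncomputable def dist (T : HomTree q) (x y : T.V) : ℕ := T.G.dist x y

/-- `x` lies below `y`. -/
def below (T : HomTree q) (x y : T.V) : Prop := T.lev x = T.lev y - T.dist x y

/-- The weighted measure `μ(A) = ∑_{x ∈ A} q^{ℓ(x)}`. -/
noncomputable def mu (T : HomTree q) (A : Set T.V) : ℝ≥0∞ :=
  ∑' x : A, (q : ℝ≥0∞) ^ (T.lev x.1)

def sphere (T : HomTree q) (x₀ : T.V) (r : ℕ) : Set T.V := {x | T.dist x x₀ = r}

def ball (T : HomTree q) (x₀ : T.V) (r : ℕ) : Set T.V := {x | T.dist x x₀ ≤ r}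

/-- An admissible trapezoid: either a degenerate singleton `{root}` (with height 1), or
the set of vertices below the root spanning levels `[h, 2h)` under it. -/
structure Trapezoid (T : HomTree q) where
  root : T.V
  height : ℕ
  degenerate : Bool
  height_pos : 1 ≤ height
  deg_height : degenerate = true → height = 1

namespace Trapezoid

variable {T : HomTree q}

/-- The vertex set of the admissible trapezoid. -/
def set (R : T.Trapezoid) : Set T.V :=
  if R.degenerate then {R.root}
  else {x | T.below x R.root ∧ (R.height : ℤ) ≤ T.lev R.root - T.lev x ∧
        T.lev R.root - T.lev x < 2 * (R.height : ℤ)}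

/-- The envelope (Calderón–Zygmund set) of the admissible trapezoid:
vertices below the root with `h/2 ≤ ℓ(x_R) - ℓ(x) < 4h`. -/
def envelope (R : T.Trapezoid) : Set T.V :=
  if R.degenerate then {R.root}
  else {x | T.below x R.root ∧ (R.height : ℤ) ≤ 2 * (T.lev R.root - T.lev x) ∧
        T.lev R.root - T.lev x < 4 * (R.height : ℤ)}

/-- The width `w(R) = q^{ℓ(x_R)}`. -/
noncomputable def width (R : T.Trapezoid) : ℝ≥0∞ := (q : ℝ≥0∞) ^ (T.lev R.root)

/-- The dilated set `R̃* = {x : d(x, R̃) < h(R̃)/4}`. -/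
def dilate (R : T.Trapezoid) : Set T.V :=
  {x | ∃ y ∈ R.envelope, 4 * T.dist x y < R.height}

end Trapezoid

/-- `‖f‖_{L^p(μ)}^p = ∑_x |f(x)|^p q^{ℓ(x)}`. -/
noncomputable def lpPow (T : HomTree q) (f : T.V → ℂ) (p : ℝ) : ℝ≥0∞ :=
  ∑' x : T.V, (‖f x‖₊ : ℝ≥0∞) ^ p * (q : ℝ≥0∞) ^ (T.lev x)

/-- `∫_A |f|^p dμ`. -/
noncomputable def setIntPow (T : HomTree q) (f : T.V → ℂ) (p : ℝ) (A : Set T.V) : ℝ≥0∞ :=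
  ∑' x : A, (‖f x.1‖₊ : ℝ≥0∞) ^ p * (q : ℝ≥0∞) ^ (T.lev x.1)

/-- `‖f‖_{L¹(μ)}`. -/
noncomputable def l1Norm (T : HomTree q) (f : T.V → ℂ) : ℝ≥0∞ :=
  ∑' x : T.V, (‖f x‖₊ : ℝ≥0∞) * (q : ℝ≥0∞) ^ (T.lev x)

/-- `‖f‖_{L²(μ)}`. -/
noncomputable def l2Norm (T : HomTree q) (f : T.V → ℂ) : ℝ≥0∞ :=
  (T.lpPow f 2) ^ (2⁻¹ : ℝ)

/-- `‖f‖_{L^{p}(μ)}` for `p ∈ ℝ≥0∞`, including `p = ∞`. -/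
noncomputable def lpNormE (T : HomTree q) (p : ℝ≥0∞) (f : T.V → ℂ) : ℝ≥0∞ :=
  if p = ⊤ then ⨆ x, (‖f x‖₊ : ℝ≥0∞) else (T.lpPow f p.toReal) ^ (p.toReal)⁻¹

/-- The trapezoidal maximal function of a nonnegative density `g`. -/
noncomputable def maxFn (T : HomTree q) (g : T.V → ℝ≥0∞) (x : T.V) : ℝ≥0∞ :=
  ⨆ (R : T.Trapezoid) (_ : x ∈ R.set),
    (∑' y : R.set, g y.1 * (q : ℝ≥0∞) ^ (T.lev y.1)) / T.mu R.set

/-- `a` is a `(1,∞)`-atom associated with the Calderón–Zygmund set `R̃`. -/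
def IsInftyAtomOn (T : HomTree q) (R : T.Trapezoid) (a : T.V → ℂ) : Prop :=
  Function.support a ⊆ R.envelope ∧
  (∀ x, (‖a x‖₊ : ℝ≥0∞) ≤ (T.mu R.envelope)⁻¹) ∧
  ∑' x : T.V, a x * (q : ℂ) ^ (T.lev x) = 0

/-- `a` is a `(1,∞)`-atom. -/
def IsInftyAtom (T : HomTree q) (a : T.V → ℂ) : Prop :=
  ∃ R : T.Trapezoid, T.IsInftyAtomOn R a

/-- `a` is a `(1,p)`-atom, `1 < p < ∞`: supported in a Calderón–Zygmund set `R̃`,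
`‖a‖_{L^p} ≤ μ(R̃)^{1/p-1}` (equivalently `‖a‖_{L^p}^p ≤ μ(R̃)^{1-p}`), vanishing integral. -/
def IspAtom (T : HomTree q) (p : ℝ) (a : T.V → ℂ) : Prop :=
  ∃ R : T.Trapezoid, Function.support a ⊆ R.envelope ∧
    T.lpPow a p ≤ (T.mu R.envelope) ^ (1 - p) ∧
    ∑' x : T.V, a x * (q : ℂ) ^ (T.lev x) = 0

/-- `h` belongs to the atomic Hardy space `H^{1,∞}(μ)`. -/
def InH1 (T : HomTree q) (h : T.V → ℂ) : Prop :=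
  ∃ (c : ℕ → ℂ) (a : ℕ → T.V → ℂ), (∀ n, T.IsInftyAtom (a n)) ∧
    Summable (fun n => ‖c n‖) ∧ ∀ x, HasSum (fun n => c n * a n x) (h x)

/-- The `H^{1,∞}(μ)` norm: infimum of `∑ |λ_j|` over atomic decompositions. -/
noncomputable def H1Norm (T : HomTree q) (h : T.V → ℂ) : ℝ≥0∞ :=
  ⨅ (c : ℕ → ℂ) (a : ℕ → T.V → ℂ)
    (_ : (∀ n, T.IsInftyAtom (a n)) ∧ ∀ x, HasSum (fun n => c n * a n x) (h x)),
    ∑' n, (‖c n‖₊ : ℝ≥0∞)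

/-- `h` belongs to the atomic Hardy space `H^{1,p}(μ)`. -/
def InH1p (T : HomTree q) (p : ℝ) (h : T.V → ℂ) : Prop :=
  ∃ (c : ℕ → ℂ) (a : ℕ → T.V → ℂ), (∀ n, T.IspAtom p (a n)) ∧
    Summable (fun n => ‖c n‖) ∧ ∀ x, HasSum (fun n => c n * a n x) (h x)

/-- The `H^{1,p}(μ)` norm. -/
noncomputable def H1pNorm (T : HomTree q) (p : ℝ) (h : T.V → ℂ) : ℝ≥0∞ :=
  ⨅ (c : ℕ → ℂ) (a : ℕ → T.V → ℂ)
    (_ : (∀ n, T.IspAtom p (a n)) ∧ ∀ x, HasSum (fun n => c n * a n x) (h x)),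
    ∑' n, (‖c n‖₊ : ℝ≥0∞)

/-- The K-functional for the couple `(H¹(μ), L^{p₁}(μ))`. -/
noncomputable def KH1Lp (T : HomTree q) (p₁ : ℝ≥0∞) (t : ℝ≥0∞) (f : T.V → ℂ) : ℝ≥0∞ :=
  ⨅ (b : T.V → ℂ) (g : T.V → ℂ) (_ : ∀ x, f x = b x + g x),
    T.H1Norm b + t * T.lpNormE p₁ g

/-- The real interpolation norm `‖f‖_{θ,pr}` for the couple `(H¹(μ), L^{p₁}(μ))`. -/
noncomputable def interpNorm (T : HomTree q) (p₁ : ℝ≥0∞) (θ pr : ℝ) (f : T.V → ℂ) : ℝ≥0∞ :=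
  (∫⁻ t in Set.Ioi (0 : ℝ),
      (T.KH1Lp p₁ (ENNReal.ofReal t) f / (ENNReal.ofReal t) ^ θ) ^ pr *
        (ENNReal.ofReal t)⁻¹) ^ (1 / pr)

/-- The distinguished Laplacian `ℒ`. -/
noncomputable def lap (T : HomTree q) (f : T.V → ℂ) (x : T.V) : ℂ :=
  f x - (1 / (2 * ((Real.sqrt q : ℝ) : ℂ))) *
    ∑' y : T.G.neighborSet x, ((Real.sqrt q : ℝ) : ℂ) ^ (T.lev y.1 - T.lev x) * f y.1

end HomTree

open HomTree


open scoped ENNReal NNReal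
open MeasureTheory Filter
open HomTree

namespace HomTree
variable {q : ℕ}

/-- The unique neighbour above a vertex. -/
noncomputable def up (T : HomTree q) (v : T.V) : T.V := (T.unique_above v).choose

lemma up_adj (T : HomTree q) (v : T.V) : T.G.Adj v (T.up v) := (T.unique_above v).choose_spec.1.1

lemma lev_up (T : HomTree q) (v : T.V) : T.lev (T.up v) = T.lev v + 1 :=
  (T.unique_above v).choose_spec.1.2

lemma eq_up (T : HomTree q) {v w : T.V} (h : T.G.Adj v w) (hl : T.lev w = T.lev v + 1) :
    w = T.up v := (T.unique_above v).choose_spec.2 w ⟨h, hl⟩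

lemma lev_up_iter (T : HomTree q) (n : ℕ) (v : T.V) : T.lev (T.up^[n] v) = T.lev v + n := by
  induction n with
  | zero => simp
  | succ k ih => rw [Function.iterate_succ_apply', lev_up, ih]; push_cast; ring

lemma adj_cases (T : HomTree q) {v w : T.V} (h : T.G.Adj v w) : w = T.up v ∨ v = T.up w := by
  rcases T.lev_adj v w h with h1 | h1
  · exact Or.inl (T.eq_up h h1)
  · exact Or.inr (T.eq_up h.symm (by omega))

lemma neighborSet_eq (T : HomTree q) (v : T.V) :
    T.G.neighborSet v = insert (T.up v) {w | T.up w = v} := by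
  ext w
  simp only [SimpleGraph.mem_neighborSet, Set.mem_insert_iff, Set.mem_ofPred_eq]
  constructor
  · intro h
    rcases T.adj_cases h with h | h
    · exact Or.inl h
    · exact Or.inr h.symm
  · rintro (h | h)
    · rw [h]; exact T.up_adj v
    · rw [← h]; exact (T.up_adj w).symm

lemma children_finite (T : HomTree q) (v : T.V) : {w | T.up w = v}.Finite := by
  have h : (T.G.neighborSet v).Finite := Set.finite_of_ncard_ne_zero (by rw [T.degree]; omega)
  rw [neighborSet_eq] at h
  exact h.subset (Set.subset_insert _ _)

lemma children_ncard (T : HomTree q) (v : T.V) : {w | T.up w = v}.ncard = q := by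
  have h := T.degree v
  rw [neighborSet_eq, Set.ncard_insert_of_notMem _ (T.children_finite v)] at h
  · omega
  · intro h
    simp only [Set.mem_ofPred_eq] at h
    have := congrArg T.lev h
    rw [lev_up, lev_up] at this
    omega

/-- Children of a vertex. -/
noncomputable def childF (T : HomTree q) (v : T.V) : Finset T.V := (T.children_finite v).toFinset

lemma mem_childF (T : HomTree q) (v w : T.V) : w ∈ T.childF v ↔ T.up w = v := by
  simp [childF]

lemma card_childF (T : HomTree q) (v : T.V) : (T.childF v).card = q := by
  rw [childF, ← Set.ncard_eq_toFinset_card _ (T.children_finite v), children_ncard]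

open Classical in
/-- Descendants at depth `d`. -/
noncomputable def descF (T : HomTree q) (r : T.V) : ℕ → Finset T.V
  | 0 => {r}
  | d + 1 => (descF T r d).biUnion T.childF

lemma mem_descF (T : HomTree q) (r : T.V) (d : ℕ) : ∀ y, y ∈ T.descF r d ↔ T.up^[d] y = r := by
  induction d with
  | zero => intro y; simp [descF]
  | succ k ih =>
    intro y
    simp [descF, ih, mem_childF, Function.iterate_succ_apply]

lemma card_descF (T : HomTree q) (r : T.V) (d : ℕ) : (T.descF r d).card = q ^ d := by
  classical
  induction d with
  | zero => simp [descF]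
  | succ k ih =>
    rw [descF, Finset.card_biUnion]
    · simp [card_childF, ih, pow_succ]
    · intro x _ y _ hxy
      rw [Function.onFun, Finset.disjoint_left]
      intro z hz hz'
      rw [mem_childF] at hz hz'
      exact hxy ((hz.symm).trans hz')

/-- The weight as a real number. -/
noncomputable def w (T : HomTree q) (x : T.V) : ℝ := (q : ℝ) ^ (T.lev x)

lemma w_pos (T : HomTree q) (hq : 2 ≤ q) (x : T.V) : 0 < T.w x := by
  unfold w
  have : (0:ℝ) < q := by exact_mod_cast (by omega : 0 < q)
  positivity

lemma ofReal_w (T : HomTree q) (hq : 2 ≤ q) (x : T.V) :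
    ENNReal.ofReal (T.w x) = (q : ℝ≥0∞) ^ (T.lev x) := by
  unfold w
  have hq' : (q : ℝ≥0∞) = ((q : ℝ≥0) : ℝ≥0∞) := by simp
  have h0 : (q : ℝ≥0) ≠ 0 := by simp; omega
  rw [hq', ← ENNReal.coe_zpow h0, ENNReal.ofReal]
  congr 1
  ext
  rw [Real.coe_toNNReal]
  · simp
  · positivity

lemma sum_descF (T : HomTree q) (hq : 2 ≤ q) (r : T.V) (d : ℕ) :
    ∑ y ∈ T.descF r d, T.w y = T.w r := by
  have h : ∀ y ∈ T.descF r d, T.w y = (q:ℝ) ^ (T.lev r - d) := by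
    intro y hy
    rw [mem_descF] at hy
    have := T.lev_up_iter d y
    rw [hy] at this
    unfold w; congr 1; omega
  rw [Finset.sum_congr rfl h, Finset.sum_const, card_descF, nsmul_eq_mul, w]
  have : (q:ℝ) ≠ 0 := by simp; omega
  rw [zpow_sub₀ this]
  push_cast
  rw [zpow_natCast]
  field_simp

open Classical in
/-- Vertices under `r` at depth in `[a, b)`. -/
noncomputable def rectF (T : HomTree q) (r : T.V) (a b : ℕ) : Finset T.V :=
  (Finset.Ico a b).biUnion (T.descF r)

lemma mem_rectF (T : HomTree q) (r : T.V) (a b : ℕ) (y : T.V) :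
    y ∈ T.rectF r a b ↔ ∃ d, a ≤ d ∧ d < b ∧ T.up^[d] y = r := by
  simp [rectF, mem_descF, and_assoc]

lemma sum_rectF (T : HomTree q) (hq : 2 ≤ q) (r : T.V) (a b : ℕ) :
    ∑ y ∈ T.rectF r a b, T.w y = ((b - a : ℕ) : ℝ) * T.w r := by
  classical
  rw [rectF, Finset.sum_biUnion]
  · simp [sum_descF T hq]
  · intro x _ y _ hxy
    rw [Function.onFun, Finset.disjoint_left]
    intro z hz hz'
    rw [mem_descF] at hz hz'
    have h1 := T.lev_up_iter x z
    have h2 := T.lev_up_iter y z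
    rw [hz] at h1; rw [hz'] at h2
    apply hxy; omega

lemma walk_lev (T : HomTree q) {y r : T.V} (p : T.G.Walk y r) :
    T.lev r ≤ T.lev y + p.length ∧ (T.lev r = T.lev y + p.length → T.up^[p.length] y = r) := by
  induction p with
  | nil => simp
  | cons h p ih =>
    rename_i u v w
    rw [SimpleGraph.Walk.length_cons]
    push_cast
    rcases T.lev_adj _ _ h with h1 | h1
    · refine ⟨by omega, fun h2 => ?_⟩
      rw [Function.iterate_succ_apply, ← T.eq_up h h1]
      exact ih.2 (by omega)
    · exact ⟨by omega, fun h2 => by omega⟩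

lemma below_iff (T : HomTree q) (y r : T.V) : T.below y r ↔ ∃ d, T.up^[d] y = r := by
  unfold below HomTree.dist
  obtain ⟨p, hp⟩ := (T.conn y r).exists_walk_length_eq_dist
  have h := T.walk_lev p
  rw [hp] at h
  constructor
  · intro h1
    exact ⟨_, h.2 (by omega)⟩
  · rintro ⟨d, hd⟩
    have h1 : T.G.dist y r ≤ d := by
      clear h hp p
      induction d generalizing r with
      | zero => simp at hd; simp [hd]
      | succ k ih =>
        rw [Function.iterate_succ_apply'] at hd
        have h2 := ih _ rfl
        have h3 : T.G.dist (T.up^[k] y) r = 1 := by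
          rw [SimpleGraph.dist_eq_one_iff_adj, ← hd]; exact T.up_adj _
        have h4 := T.conn.dist_triangle (u := y) (v := T.up^[k] y) (w := r)
        omega
    have h2 := T.lev_up_iter d y
    rw [hd] at h2
    omega

lemma mu_finset (T : HomTree q) (hq : 2 ≤ q) (F : Finset T.V) :
    T.mu (F : Set T.V) = ENNReal.ofReal (∑ x ∈ F, T.w x) := by
  unfold mu
  rw [Finset.tsum_subtype' F (fun x => (q : ℝ≥0∞) ^ (T.lev x)), ENNReal.ofReal_sum_of_nonneg]
  · exact Finset.sum_congr rfl fun x _ => (T.ofReal_w hq x).symm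
  · exact fun x _ => (T.w_pos hq x).le

lemma mu_mono (T : HomTree q) {A B : Set T.V} (h : A ⊆ B) : T.mu A ≤ T.mu B :=
  ENNReal.tsum_mono_subtype (fun x => (q : ℝ≥0∞) ^ (T.lev x)) h

/-- Every good rectangle sits in a Calderon-Zygmund set of comparable measure. -/
lemma rect_env (T : HomTree q) (hq : 2 ≤ q) (r : T.V) (a L : ℕ) (h1 : 1 ≤ a) (h2 : L ≤ 2 * a)
    (h3 : a ≤ 2 * L) : ∃ R : T.Trapezoid, ((T.rectF r a (a + L) : Finset T.V) : Set T.V) ⊆ R.envelope ∧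
      T.mu R.envelope ≤ ENNReal.ofReal (8 * ∑ x ∈ T.rectF r a (a + L), T.w x) := by
  refine ⟨⟨r, a, false, h1, by simp⟩, ?_, ?_⟩
  · intro y hy
    rw [Finset.mem_coe, mem_rectF] at hy
    obtain ⟨d, hd1, hd2, hd⟩ := hy
    have := T.lev_up_iter d y
    rw [hd] at this
    simp only [Trapezoid.envelope]
    refine ⟨(T.below_iff _ _).2 ⟨d, hd⟩, ?_, ?_⟩ <;> omega
  · have : (Trapezoid.envelope (T := T) ⟨r, a, false, h1, by simp⟩) ⊆ (T.rectF r 0 (4 * a) : Set T.V) := by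
      intro y hy
      simp only [Trapezoid.envelope] at hy
      obtain ⟨hb, h4, h5⟩ := hy
      obtain ⟨d, hd⟩ := (T.below_iff _ _).1 hb
      rw [Finset.mem_coe, mem_rectF]
      have := T.lev_up_iter d y
      rw [hd] at this
      exact ⟨d, by omega, by omega, hd⟩
    refine (T.mu_mono this).trans ?_
    rw [T.mu_finset hq]
    apply ENNReal.ofReal_le_ofReal
    rw [sum_rectF T hq, sum_rectF T hq, ← mul_assoc]
    apply mul_le_mul_of_nonneg_right _ (T.w_pos hq r).le
    simp only [Nat.add_sub_cancel_left, Nat.sub_zero]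
    have : (a:ℝ) ≤ 2 * L := by exact_mod_cast h3
    push_cast
    linarith

lemma single_env (T : HomTree q) (hq : 2 ≤ q) (r : T.V) :
    ∃ R : T.Trapezoid, ({r} : Set T.V) ⊆ R.envelope ∧
      T.mu R.envelope ≤ ENNReal.ofReal (8 * T.w r) := by
  refine ⟨⟨r, 1, true, le_rfl, by simp⟩, ?_, ?_⟩
  · simp [Trapezoid.envelope]
  · have := T.mu_finset hq {r}
    simp only [Finset.coe_singleton, Finset.sum_singleton] at this
    simp only [Trapezoid.envelope, if_true]
    rw [this]
    apply ENNReal.ofReal_le_ofReal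
    linarith [T.w_pos hq r]

lemma exists_common (T : HomTree q) (o x : T.V) : ∃ n m, T.up^[n] x = T.up^[m] o := by
  obtain ⟨p⟩ := T.conn x o
  induction p with
  | nil => exact ⟨0, 0, rfl⟩
  | cons h p ih =>
    rename_i u v w
    obtain ⟨n, m, h1⟩ := ih
    rcases T.adj_cases h with h2 | h2
    · refine ⟨n + 1, m, ?_⟩
      rw [Function.iterate_succ_apply, ← h2, h1]
    · refine ⟨n, m + 1, ?_⟩
      rw [Function.iterate_succ_apply', ← h1, h2, ← Function.iterate_succ_apply, Function.iterate_succ_apply']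

lemma countable_V (T : HomTree q) : Countable T.V := by
  rw [← Set.countable_univ_iff]
  have : (Set.univ : Set T.V) ⊆ ⋃ n : ℕ, ⋃ m : ℕ, (T.descF (T.up^[m] (T.geo 0)) n : Set T.V) := by
    intro x _
    obtain ⟨n, m, h⟩ := T.exists_common (T.geo 0) x
    simp only [Set.mem_iUnion, Finset.mem_coe, mem_descF]
    exact ⟨n, m, h⟩
  exact Set.Countable.mono this (Set.countable_iUnion fun n => Set.countable_iUnion fun m =>
    Finset.countable_toSet _)

end HomTree

open scoped ENNReal NNReal
open MeasureTheory Filter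
open HomTree

namespace HomTree
variable {q : ℕ}

/-- A regular filtration by sets comparable to Calderon-Zygmund sets. -/
structure Filt (T : HomTree q) (s : ℤ) where
  S : ℕ → T.V → Finset T.V
  self : ∀ n x, x ∈ S n x
  eq : ∀ n x y, y ∈ S n x → S n y = S n x
  anti : ∀ n x, S (n+1) x ⊆ S n x
  reg : ∀ n x, ∑ y ∈ S n x, T.w y ≤ q * ∑ y ∈ S (n+1) x, T.w y
  fin : ∀ x, ∃ N, S N x = {x}
  env : ∀ n x, ∃ R : T.Trapezoid, (S n x : Set T.V) ⊆ R.envelope ∧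
    T.mu R.envelope ≤ ENNReal.ofReal (8 * ∑ y ∈ S n x, T.w y)
  top : ∀ x, (q:ℝ)^s ≤ ∑ y ∈ S 0 x, T.w y

/-- State of the cutting procedure: root level, first depth, log of the height. -/
structure CZState where
  k : ℤ
  a : ℕ
  m : ℕ

namespace CZState

/-- One cut. -/
def step (l : ℤ) (σ : CZState) : CZState :=
  if σ.a = 0 then σ
  else if 2 ^ σ.m < 2 * σ.a then ⟨σ.k - 1, σ.a - 1, σ.m⟩
  else if σ.k - l < σ.a + 2 ^ (σ.m - 1) then ⟨σ.k, σ.a, σ.m - 1⟩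
  else ⟨σ.k, σ.a + 2 ^ (σ.m - 1), σ.m - 1⟩

/-- Initial state. -/
def startSt (s l : ℤ) : CZState :=
  if s ≤ l then ⟨l, 0, 0⟩ else ⟨s, 2 ^ (Nat.log 2 (s - l).toNat), Nat.log 2 (s - l).toNat⟩

/-- State after `n` cuts. -/
def st (s l : ℤ) : ℕ → CZState
  | 0 => startSt s l
  | n + 1 => step l (st s l n)

/-- The level `l` is in the band of the state. -/
def band (σ : CZState) (l : ℤ) : Prop := (σ.a : ℤ) ≤ σ.k - l ∧ σ.k - l < σ.a + 2 ^ σ.m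

/-- Shape invariant. -/
def Inv (σ : CZState) : Prop :=
  (σ.a = 0 ∧ σ.m = 0) ∨ (1 ≤ σ.a ∧ 2 ^ σ.m ≤ 2 * σ.a ∧ σ.a ≤ 2 * 2 ^ σ.m)

/-- Possible transitions. -/
lemma step_cases (l : ℤ) (σ : CZState) (hi : σ.Inv) (hb : σ.band l) :
    (σ.a = 0 ∧ σ.m = 0 ∧ step l σ = σ) ∨
    (1 ≤ σ.a ∧ 2 ^ σ.m < 2 * σ.a ∧ step l σ = ⟨σ.k - 1, σ.a - 1, σ.m⟩) ∨
    (∃ j, σ.m = j + 1 ∧ σ.a = 2 ^ j ∧ σ.k - l < σ.a + 2 ^ j ∧ step l σ = ⟨σ.k, σ.a, j⟩) ∨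
    (∃ j, σ.m = j + 1 ∧ σ.a = 2 ^ j ∧ σ.a + 2 ^ j ≤ σ.k - l ∧ step l σ = ⟨σ.k, σ.a + 2 ^ j, j⟩) := by
  obtain ⟨k, a, m⟩ := σ
  simp only [Inv, band] at hi hb
  rcases hi with ⟨h1, h2⟩ | ⟨h1, h2, h3⟩
  · left; simp [h1, h2, step]
  · right
    by_cases h4 : 2 ^ m < 2 * a
    · left
      refine ⟨h1, h4, ?_⟩
      simp only [step]
      rw [if_neg (by omega), if_pos h4]
    · right
      rcases m with _ | j
      · simp at h4; omega
      · have h5 : a = 2 ^ j := by rw [pow_succ] at h2 h4; omega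
        by_cases h6 : k - l < a + 2 ^ j
        · left
          refine ⟨j, rfl, h5, h6, ?_⟩
          simp only [step]
          rw [if_neg (by omega), if_neg h4]
          simp [h6]
        · right
          refine ⟨j, rfl, h5, by simp only; omega, ?_⟩
          simp only [step]
          rw [if_neg (by omega), if_neg h4]
          simp [h6]

lemma step_inv (l : ℤ) (σ : CZState) (hi : σ.Inv) (hb : σ.band l) :
    (step l σ).Inv ∧ (step l σ).band l := by
  rcases step_cases l σ hi hb with ⟨h1, h2, h3⟩ | ⟨h1, h2, h3⟩ | ⟨j, h1, h2, h3, h4⟩ | ⟨j, h1, h2, h3, h4⟩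
  · rw [h3]; exact ⟨hi, hb⟩
  · rw [h3]
    obtain ⟨k, a, m⟩ := σ
    simp only [Inv, band] at *
    have hp : 1 ≤ 2 ^ m := Nat.one_le_two_pow
    refine ⟨?_, by omega, by omega⟩
    rcases m with _ | m
    · simp at *; omega
    · have hp : 1 ≤ 2 ^ m := Nat.one_le_two_pow
      rw [pow_succ] at *; omega
  · rw [h4]
    obtain ⟨k, a, m⟩ := σ
    simp only [Inv, band] at *
    have hp : 1 ≤ 2 ^ j := Nat.one_le_two_pow
    subst h1 h2
    rw [pow_succ] at *
    push_cast at *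
    refine ⟨?_, by omega, by omega⟩
    omega
  · rw [h4]
    obtain ⟨k, a, m⟩ := σ
    simp only [Inv, band] at *
    have hp : 1 ≤ 2 ^ j := Nat.one_le_two_pow
    subst h1 h2
    rw [pow_succ] at *
    push_cast at *
    refine ⟨?_, by omega, by omega⟩
    omega

lemma startSt_inv (s l : ℤ) : (startSt s l).Inv ∧ (startSt s l).band l := by
  unfold startSt
  split_ifs with h
  · simp [Inv, band]
  · simp only [Inv, band]
    have hp : 1 ≤ 2 ^ (Nat.log 2 (s - l).toNat) := Nat.one_le_two_pow
    have h1 : 2 ^ (Nat.log 2 (s - l).toNat) ≤ (s - l).toNat := Nat.pow_log_le_self 2 (by omega)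
    have h2 : (s - l).toNat < 2 ^ (Nat.log 2 (s - l).toNat + 1) := Nat.lt_pow_succ_log_self (by norm_num) _
    rw [pow_succ] at h2
    zify at h1 h2
    rw [Int.toNat_of_nonneg (by omega)] at h1 h2
    refine ⟨by omega, ?_, ?_⟩
    · push_cast; exact h1
    · push_cast; omega

lemma st_inv (s l : ℤ) (n : ℕ) : (st s l n).Inv ∧ (st s l n).band l := by
  induction n with
  | zero => exact startSt_inv s l
  | succ n ih => exact step_inv l _ ih.1 ih.2

lemma startSt_eq (s l l' : ℤ) (h : (startSt s l).band l') : startSt s l' = startSt s l := by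
  unfold startSt at h ⊢
  split_ifs at h with h1
  · simp only [band] at h
    have : l' = l := by simp at h; omega
    rw [this]
  · simp only [band] at h
    have hp : 1 ≤ 2 ^ (Nat.log 2 (s - l).toNat) := Nat.one_le_two_pow
    push_cast at h
    have hp' : (1:ℤ) ≤ 2 ^ (Nat.log 2 (s - l).toNat) := by exact_mod_cast hp
    rw [if_neg (by omega), if_neg h1]
    have : Nat.log 2 (s - l').toNat = Nat.log 2 (s - l).toNat := by
      apply Nat.log_eq_of_pow_le_of_lt_pow
      · zify; rw [Int.toNat_of_nonneg (by omega)]; exact h.1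
      · zify; rw [Int.toNat_of_nonneg (by omega), pow_succ]; omega
    rw [this]

lemma step_band (l l' : ℤ) (σ : CZState) (hi : σ.Inv) (hb : σ.band l)
    (h : (step l σ).band l') : σ.band l' ∧ step l' σ = step l σ := by
  have key : σ.band l' := by
    rcases step_cases l σ hi hb with ⟨h1, h2, h3⟩ | ⟨h1, h2, h3⟩ | ⟨j, h1, h2, h3, h4⟩ | ⟨j, h1, h2, h3, h4⟩
    · rw [h3] at h; exact h
    · rw [h3] at h
      obtain ⟨k, a, m⟩ := σ
      simp only [band] at *
      omega
    · rw [h4] at h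
      obtain ⟨k, a, m⟩ := σ
      simp only [band] at *
      subst h1
      rw [pow_succ] at *
      have hp : (1:ℤ) ≤ 2 ^ j := by exact_mod_cast Nat.one_le_two_pow
      omega
    · rw [h4] at h
      obtain ⟨k, a, m⟩ := σ
      simp only [band] at *
      subst h1
      rw [pow_succ] at *
      push_cast at *
      have hp : (1:ℤ) ≤ 2 ^ j := by exact_mod_cast Nat.one_le_two_pow
      omega
  refine ⟨key, ?_⟩
  have hp : ∀ j, (1:ℤ) ≤ 2 ^ j := fun j => by exact_mod_cast Nat.one_le_two_pow
  rcases step_cases l σ hi hb with ⟨h1, h2, h3⟩ | ⟨h1, h2, h3⟩ | ⟨j, h1, h2, h3, h4⟩ | ⟨j, h1, h2, h3, h4⟩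
  · simp [step, h1]
  · simp only [step]
    rw [if_neg (by omega), if_pos h2, if_neg (by omega), if_pos h2]
  · rw [h4] at h ⊢
    obtain ⟨k, a, m⟩ := σ
    simp only [band] at *
    subst h1
    have h5 : ¬ (a = 0) := by rw [h2]; positivity
    have h6 : ¬ (2 ^ (j+1) < 2 * a) := by rw [h2, pow_succ]; omega
    simp only [step]
    rw [if_neg h5, if_neg h6, if_pos (by simpa using h.2)]
    simp
  · rw [h4] at h ⊢
    obtain ⟨k, a, m⟩ := σ
    simp only [band] at *
    subst h1
    have h5 : ¬ (a = 0) := by rw [h2]; positivity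
    have h6 : ¬ (2 ^ (j+1) < 2 * a) := by rw [h2, pow_succ]; omega
    simp only [step]
    push_cast at h
    rw [if_neg h5, if_neg h6, if_neg (by simpa using h.1)]
    simp

lemma st_eq (s l l' : ℤ) (n : ℕ) (h : (st s l n).band l') : st s l' n = st s l n := by
  induction n with
  | zero => exact startSt_eq s l l' h
  | succ n ih =>
    have hi := st_inv s l n
    have h1 := step_band l l' _ hi.1 hi.2 h
    simp only [st]
    rw [ih h1.1, h1.2]

lemma st_fin (s l : ℤ) : ∃ N, (st s l N).a = 0 := by
  by_contra! hcon
  have : ∀ n, (st s l n).a + 2 * 2 ^ (st s l n).m + n ≤ (st s l 0).a + 2 * 2 ^ (st s l 0).m := by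
    intro n
    induction n with
    | zero => simp
    | succ n ih =>
      have hi := st_inv s l n
      have h0 := hcon n
      have : (st s l (n+1)).a + 2 * 2 ^ (st s l (n+1)).m + 1 ≤ (st s l n).a + 2 * 2 ^ (st s l n).m := by
        simp only [st]
        rcases step_cases l _ hi.1 hi.2 with ⟨h1, h2, h3⟩ | ⟨h1, h2, h3⟩ | ⟨j, h1, h2, h3, h4⟩ | ⟨j, h1, h2, h3, h4⟩
        · omega
        · rw [h3]; simp only; omega
        · rw [h4, h1, pow_succ]; simp only
          have hp : 1 ≤ 2 ^ j := Nat.one_le_two_pow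
          omega
        · rw [h4, h1, pow_succ]; simp only
          have hp : 1 ≤ 2 ^ j := Nat.one_le_two_pow
          omega
      omega
  have := this ((st s l 0).a + 2 * 2 ^ (st s l 0).m + 1)
  omega

end CZState

open CZState

/-- Root of the cell. -/
noncomputable def cellRoot (T : HomTree q) (s : ℤ) (n : ℕ) (x : T.V) : T.V :=
  T.up^[((st s (T.lev x) n).k - T.lev x).toNat] x

/-- Cell containing `x`. -/
noncomputable def cell (T : HomTree q) (s : ℤ) (n : ℕ) (x : T.V) : Finset T.V :=
  T.rectF (T.cellRoot s n x) (st s (T.lev x) n).a ((st s (T.lev x) n).a + 2 ^ (st s (T.lev x) n).m)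

lemma lev_cellRoot (T : HomTree q) (s : ℤ) (n : ℕ) (x : T.V) :
    T.lev (T.cellRoot s n x) = (st s (T.lev x) n).k := by
  have h := (st_inv s (T.lev x) n).2.1
  rw [cellRoot, lev_up_iter, Int.toNat_of_nonneg (by omega)]
  ring

lemma sum_cell (T : HomTree q) (hq : 2 ≤ q) (s : ℤ) (n : ℕ) (x : T.V) :
    ∑ y ∈ T.cell s n x, T.w y = 2 ^ (st s (T.lev x) n).m * (q:ℝ) ^ (st s (T.lev x) n).k := by
  rw [cell, sum_rectF T hq, w, lev_cellRoot]
  simp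

lemma cell_self (T : HomTree q) (s : ℤ) (n : ℕ) (x : T.V) : x ∈ T.cell s n x := by
  have h := (st_inv s (T.lev x) n).2
  rw [cell, mem_rectF]
  refine ⟨_, ?_, ?_, rfl⟩
  · have := h.1; omega
  · have := h.2; zify; rw [Int.toNat_of_nonneg (by have := h.1; omega)]; exact this

lemma cell_singleton (T : HomTree q) (s : ℤ) (n : ℕ) (x : T.V) (h0 : (st s (T.lev x) n).a = 0) :
    T.cell s n x = {x} := by
  have hm : (st s (T.lev x) n).m = 0 := by
    rcases (st_inv s (T.lev x) n).1 with h | h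
    · exact h.2
    · omega
  have hs := T.cell_self s n x
  ext y
  rw [Finset.mem_singleton]
  constructor
  · intro hy
    rw [cell, mem_rectF, h0, hm] at hy hs
    obtain ⟨d, h1, h2, h3⟩ := hy
    obtain ⟨d', h1', h2', h3'⟩ := hs
    have e : d = 0 := by simpa using h2
    have e' : d' = 0 := by simpa using h2'
    subst e e'
    simp at h3 h3'
    rw [h3, ← h3']
  · rintro rfl; exact hs

lemma cell_eq (T : HomTree q) (s : ℤ) (n : ℕ) (x y : T.V) (h : y ∈ T.cell s n x) :
    T.cell s n y = T.cell s n x := by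
  rw [cell, mem_rectF] at h
  obtain ⟨d, h1, h2, h3⟩ := h
  have hl := T.lev_up_iter d y
  rw [h3, lev_cellRoot] at hl
  have hst : st s (T.lev y) n = st s (T.lev x) n := by
    apply st_eq
    constructor
    · omega
    · zify at h2; omega
  have hr : T.cellRoot s n y = T.cellRoot s n x := by
    rw [← h3, cellRoot, hst]
    congr 1
    congr 1
    omega
  rw [cell, cell, hr, hst]

lemma cell_step (T : HomTree q) (hq : 2 ≤ q) (s : ℤ) (n : ℕ) (x : T.V) :
    T.cell s (n+1) x ⊆ T.cell s n x ∧
      ∑ y ∈ T.cell s n x, T.w y ≤ q * ∑ y ∈ T.cell s (n+1) x, T.w y := by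
  have hi := st_inv s (T.lev x) n
  have hsub : ∀ y ∈ T.cell s (n+1) x, y ∈ T.cell s n x := by
    intro y hy
    have hb := hi.2.1
    rw [cell, mem_rectF] at hy ⊢
    obtain ⟨d, h1, h2, h3⟩ := hy
    simp only [cellRoot, st] at h1 h2 h3 ⊢
    rcases step_cases _ _ hi.1 hi.2 with ⟨g1, g2, g3⟩ | ⟨g1, g2, g3⟩ | ⟨j, g1, g2, g3, g4⟩ | ⟨j, g1, g2, g3, g4⟩
    · rw [g3] at h1 h2 h3
      exact ⟨d, h1, h2, h3⟩
    · rw [g3] at h1 h2 h3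
      simp only at h1 h2 h3
      refine ⟨d + 1, by omega, by omega, ?_⟩
      rw [Function.iterate_succ_apply', h3, ← Function.iterate_succ_apply' T.up]
      congr 1
      congr 1
      omega
    · rw [g4] at h1 h2 h3
      simp only at h1 h2 h3
      refine ⟨d, by omega, ?_, h3⟩
      rw [g1, pow_succ]; omega
    · rw [g4] at h1 h2 h3
      simp only at h1 h2 h3
      refine ⟨d, by omega, ?_, h3⟩
      rw [g1, pow_succ]; omega
  refine ⟨hsub, ?_⟩
  have hq2 : (2:ℝ) ≤ q := by exact_mod_cast hq
  have hq0 : (q:ℝ) ≠ 0 := by positivity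
  rw [sum_cell T hq, sum_cell T hq]
  simp only [st]
  rcases step_cases _ _ hi.1 hi.2 with ⟨g1, g2, g3⟩ | ⟨g1, g2, g3⟩ | ⟨j, g1, g2, g3, g4⟩ | ⟨j, g1, g2, g3, g4⟩
  · rw [g3]
    apply le_mul_of_one_le_left
    · positivity
    · linarith
  · rw [g3]
    simp only
    rw [zpow_sub_one₀ hq0]
    apply le_of_eq; field_simp
  · rw [g4, g1]
    simp only
    rw [pow_succ]
    have : 0 ≤ (2:ℝ) ^ j * (q:ℝ) ^ (st s (T.lev x) n).k := by positivity
    nlinarith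
  · rw [g4, g1]
    simp only
    rw [pow_succ]
    have : 0 ≤ (2:ℝ) ^ j * (q:ℝ) ^ (st s (T.lev x) n).k := by positivity
    nlinarith

/-- The filtration. -/
noncomputable def filt (T : HomTree q) (hq : 2 ≤ q) (s : ℤ) : T.Filt s where
  S := T.cell s
  self := T.cell_self s
  eq := T.cell_eq s
  anti n x := (T.cell_step hq s n x).1
  reg n x := (T.cell_step hq s n x).2
  fin x := by
    obtain ⟨N, hN⟩ := st_fin s (T.lev x)
    exact ⟨N, T.cell_singleton s N x hN⟩
  env n x := by
    rcases (st_inv s (T.lev x) n).1 with h | ⟨h1, h2, h3⟩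
    · rw [T.cell_singleton s n x h.1]
      have := T.single_env hq x
      simpa using this
    · exact T.rect_env hq _ _ _ h1 h2 h3
  top x := by
    rw [sum_cell T hq]
    have hq2 : (1:ℝ) ≤ q := by exact_mod_cast (by omega : 1 ≤ q)
    simp only [st, startSt]
    split_ifs with h
    · simpa using zpow_le_zpow_right₀ hq2 h
    · simp only
      apply le_mul_of_one_le_left
      · positivity
      · exact one_le_pow₀ (by norm_num)

end HomTree

open scoped ENNReal NNReal
open MeasureTheory Filter
open HomTree

namespace HomTree
variable {q : ℕ}

/-- Weight of a finite set. -/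
noncomputable def wS (T : HomTree q) (F : Finset T.V) : ℝ := ∑ y ∈ F, T.w y

/-- Integral of `|f|` on a finite set. -/
noncomputable def fS (T : HomTree q) (f : T.V → ℂ) (F : Finset T.V) : ℝ := ∑ y ∈ F, ‖f y‖ * T.w y

lemma wS_pos (T : HomTree q) (hq : 2 ≤ q) {F : Finset T.V} (h : F.Nonempty) : 0 < T.wS F :=
  Finset.sum_pos (fun x _ => T.w_pos hq x) h

lemma wS_nonneg (T : HomTree q) (hq : 2 ≤ q) (F : Finset T.V) : 0 ≤ T.wS F :=
  Finset.sum_nonneg (fun x _ => (T.w_pos hq x).le)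

lemma fS_mono (T : HomTree q) (hq : 2 ≤ q) (f : T.V → ℂ) {F G : Finset T.V} (h : F ⊆ G) :
    T.fS f F ≤ T.fS f G :=
  Finset.sum_le_sum_of_subset_of_nonneg h
    fun x _ _ => mul_nonneg (norm_nonneg _) (T.w_pos hq x).le

/-- The function `|f| w` cut to the set where `|f| > lam / 2`. -/
noncomputable def hh (T : HomTree q) (f : T.V → ℂ) (lam : ℝ) (x : T.V) : ℝ :=
  if lam / 2 < ‖f x‖ then ‖f x‖ * T.w x else 0

lemma hh_nonneg (T : HomTree q) (hq : 2 ≤ q) (f : T.V → ℂ) (lam : ℝ) (x : T.V) :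
    0 ≤ T.hh f lam x := by
  unfold hh
  split_ifs
  · exact mul_nonneg (norm_nonneg _) (T.w_pos hq x).le
  · exact le_rfl

lemma fS_le_hh (T : HomTree q) (hq : 2 ≤ q) (f : T.V → ℂ) (lam : ℝ) (hl : 0 < lam)
    (F : Finset T.V) : T.fS f F ≤ ∑ x ∈ F, T.hh f lam x + lam / 2 * T.wS F := by
  unfold fS wS
  rw [Finset.mul_sum, ← Finset.sum_add_distrib]
  apply Finset.sum_le_sum
  intro x _
  have := T.w_pos hq x
  unfold hh
  split_ifs with h
  · have : 0 ≤ lam / 2 * T.w x := by positivity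
    linarith
  · rw [zero_add]; exact mul_le_mul_of_nonneg_right (not_lt.1 h) this.le

namespace Filt

variable {T : HomTree q} {s : ℤ} (Φ : T.Filt s) (f : T.V → ℂ)

/-- The cell has large average. -/
def bad (lam : ℝ) (n : ℕ) (x : T.V) : Prop := lam * T.wS (Φ.S n x) < T.fS f (Φ.S n x)

/-- The exceptional set. -/
def E (lam : ℝ) : Set T.V := {x | ∃ n, Φ.bad f lam n x}

open Classical in
/-- The stopping cell. -/
noncomputable def C (lam : ℝ) (x : T.V) : Finset T.V :=
  if h : ∃ n, Φ.bad f lam n x then Φ.S (Nat.find h) x else {x}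

/-- The good part. -/
noncomputable def g (lam : ℝ) (x : T.V) : ℂ :=
  (∑ y ∈ Φ.C f lam x, f y * (T.w y : ℂ)) / (T.wS (Φ.C f lam x) : ℂ)

lemma S_mono {n m : ℕ} (h : n ≤ m) (x : T.V) : Φ.S m x ⊆ Φ.S n x := by
  induction h with
  | refl => exact fun _ h => h
  | step _ ih => exact (Φ.anti _ x).trans ih

lemma S_eq {n m : ℕ} (h : n ≤ m) {x y : T.V} (hy : y ∈ Φ.S m x) : Φ.S n y = Φ.S n x :=
  Φ.eq n x y (Φ.S_mono h x hy)

variable {f} {lam : ℝ}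

lemma C_of_bad {n : ℕ} {x : T.V} (h : Φ.bad f lam n x) (h' : ∀ m < n, ¬ Φ.bad f lam m x) :
    Φ.C f lam x = Φ.S n x := by
  classical
  have hex : ∃ n, Φ.bad f lam n x := ⟨n, h⟩
  unfold C
  rw [dif_pos hex, (Nat.find_eq_iff hex).2 ⟨h, h'⟩]

lemma exists_bad {x : T.V} (h : x ∈ Φ.E f lam) :
    ∃ n, Φ.C f lam x = Φ.S n x ∧ Φ.bad f lam n x ∧ ∀ m < n, ¬ Φ.bad f lam m x := by
  classical
  have h : ∃ n, Φ.bad f lam n x := h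
  have h1 := Nat.find_spec h
  have h2 : ∀ m < Nat.find h, ¬ Φ.bad f lam m x := fun m hm => Nat.find_min h hm
  exact ⟨_, Φ.C_of_bad h1 h2, h1, h2⟩

lemma C_not {x : T.V} (h : x ∉ Φ.E f lam) : Φ.C f lam x = {x} := by
  have h : ¬ ∃ n, Φ.bad f lam n x := h
  unfold C
  rw [dif_neg h]

lemma C_self (x : T.V) : x ∈ Φ.C f lam x := by
  by_cases h : x ∈ Φ.E f lam
  · obtain ⟨n, h1, _⟩ := Φ.exists_bad h
    rw [h1]; exact Φ.self n x
  · rw [Φ.C_not h]; simp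

lemma bad_congr {n : ℕ} {x y : T.V} (h : Φ.S n y = Φ.S n x) :
    Φ.bad f lam n y ↔ Φ.bad f lam n x := by
  unfold bad; rw [h]

lemma C_eq {x y : T.V} (hy : y ∈ Φ.C f lam x) : Φ.C f lam y = Φ.C f lam x := by
  by_cases h : x ∈ Φ.E f lam
  · obtain ⟨n, h1, h2, h3⟩ := Φ.exists_bad h
    rw [h1] at hy ⊢
    rw [← Φ.eq n x y hy]
    refine Φ.C_of_bad ((Φ.bad_congr (Φ.S_eq le_rfl hy)).2 h2) ?_
    intro m hm
    rw [Φ.bad_congr (Φ.S_eq hm.le hy)]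
    exact h3 m hm
  · rw [Φ.C_not h] at hy
    rw [Finset.mem_singleton.1 hy]

lemma mem_E_of {x y : T.V} (h : x ∈ Φ.E f lam) (hy : y ∈ Φ.C f lam x) : y ∈ Φ.E f lam := by
  obtain ⟨n, h1, h2, h3⟩ := Φ.exists_bad h
  rw [h1] at hy
  exact ⟨n, (Φ.bad_congr (Φ.S_eq le_rfl hy)).2 h2⟩

lemma E_anti (hq : 2 ≤ q) {lam' : ℝ} (hl : lam ≤ lam') : Φ.E f lam' ⊆ Φ.E f lam := by
  rintro x ⟨n, h⟩
  exact ⟨n, lt_of_le_of_lt (mul_le_mul_of_nonneg_right hl (T.wS_nonneg hq _)) h⟩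

lemma C_mono (hq : 2 ≤ q) {lam' : ℝ} (hl : lam ≤ lam') (x : T.V) :
    Φ.C f lam' x ⊆ Φ.C f lam x := by
  by_cases h : x ∈ Φ.E f lam'
  · obtain ⟨n, h1, h2, h3⟩ := Φ.exists_bad h
    obtain ⟨m, h4, h5, h6⟩ := Φ.exists_bad (Φ.E_anti hq hl h)
    rw [h1, h4]
    apply Φ.S_mono
    by_contra! hlt
    exact h6 n hlt (lt_of_le_of_lt (mul_le_mul_of_nonneg_right hl (T.wS_nonneg hq _)) h2)
  · rw [Φ.C_not h]
    simpa using Φ.C_self x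

lemma wC_pos (hq : 2 ≤ q) (x : T.V) : 0 < T.wS (Φ.C f lam x) := T.wS_pos hq ⟨x, Φ.C_self x⟩

lemma norm_le_of_not (hq : 2 ≤ q) {x : T.V} (h : x ∉ Φ.E f lam) : ‖f x‖ ≤ lam := by
  obtain ⟨N, hN⟩ := Φ.fin x
  by_contra! hlt
  apply h
  refine ⟨N, ?_⟩
  unfold bad
  rw [hN]
  simp only [wS, fS, Finset.sum_singleton]
  exact mul_lt_mul_of_pos_right hlt (T.w_pos hq x)

lemma g_of_not (hq : 2 ≤ q) {x : T.V} (h : x ∉ Φ.E f lam) : Φ.g f lam x = f x := by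
  unfold g
  rw [Φ.C_not h]
  simp only [wS, Finset.sum_singleton]
  have : (T.w x : ℂ) ≠ 0 := by exact_mod_cast (T.w_pos hq x).ne'
  field_simp

lemma fS_C_le (hq : 2 ≤ q) (hl : 0 < lam) (htop : ∀ x, ¬ Φ.bad f lam 0 x) (x : T.V) :
    T.fS f (Φ.C f lam x) ≤ q * lam * T.wS (Φ.C f lam x) := by
  have hq2 : (2:ℝ) ≤ q := by exact_mod_cast hq
  by_cases h : x ∈ Φ.E f lam
  · obtain ⟨n, h1, h2, h3⟩ := Φ.exists_bad h
    rcases n with _ | n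
    · exact absurd h2 (htop x)
    · rw [h1]
      have h4 := h3 n (by omega)
      unfold bad at h4
      have h5 := T.fS_mono hq f (Φ.anti n x)
      have h6 : T.wS (Φ.S n x) ≤ q * T.wS (Φ.S (n+1) x) := Φ.reg n x
      have h7 := mul_le_mul_of_nonneg_left h6 hl.le
      nlinarith
  · rw [Φ.C_not h]
    have := Φ.norm_le_of_not hq h
    simp only [wS, fS, Finset.sum_singleton]
    apply mul_le_mul_of_nonneg_right _ (T.w_pos hq x).le
    nlinarith

lemma g_bound (hq : 2 ≤ q) (hl : 0 < lam) (htop : ∀ x, ¬ Φ.bad f lam 0 x) (x : T.V) :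
    ‖Φ.g f lam x‖ ≤ q * lam := by
  unfold g
  have hw := Φ.wC_pos (f := f) (lam := lam) hq x
  rw [norm_div, Complex.norm_real, Real.norm_of_nonneg hw.le, div_le_iff₀ hw]
  refine le_trans ?_ (Φ.fS_C_le hq hl htop x)
  refine (norm_sum_le _ _).trans (le_of_eq ?_)
  apply Finset.sum_congr rfl
  intro y _
  rw [norm_mul, Complex.norm_real, Real.norm_of_nonneg (T.w_pos hq y).le]

lemma weak_cell (hq : 2 ≤ q) (hl : 0 < lam) {x : T.V} (h : x ∈ Φ.E f lam) :
    lam * T.wS (Φ.C f lam x) ≤ 2 * ∑ y ∈ Φ.C f lam x, T.hh f lam y := by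
  obtain ⟨n, h1, h2, h3⟩ := Φ.exists_bad h
  rw [h1]
  unfold bad at h2
  have := T.fS_le_hh hq f lam hl (Φ.S n x)
  linarith

/-- Conditional expectations preserve integrals. -/
lemma sum_g (hq : 2 ≤ q) {lam' : ℝ} (hl : lam ≤ lam') (x : T.V) :
    ∑ y ∈ Φ.C f lam x, Φ.g f lam' y * (T.w y : ℂ) = ∑ y ∈ Φ.C f lam x, f y * (T.w y : ℂ) := by
  classical
  set Q := Φ.C f lam x with hQ
  have hsub : ∀ y ∈ Q, Φ.C f lam' y ⊆ Q := by
    intro y hy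
    rw [hQ, ← Φ.C_eq hy]
    exact Φ.C_mono hq hl y
  have hsymm : ∀ y z, z ∈ Φ.C f lam' y ↔ y ∈ Φ.C f lam' z := by
    intro y z
    constructor
    · intro h; rw [Φ.C_eq h]; exact Φ.C_self y
    · intro h; rw [Φ.C_eq h]; exact Φ.C_self z
  have h1 : ∀ y ∈ Q, Φ.g f lam' y * (T.w y : ℂ) =
      ∑ z ∈ Q, if z ∈ Φ.C f lam' y then f z * (T.w z : ℂ) * (T.w y : ℂ) / (T.wS (Φ.C f lam' z) : ℂ) else 0 := by
    intro y hy
    rw [← Finset.sum_filter, Finset.filter_mem_eq_inter, Finset.inter_eq_right.2 (hsub y hy)]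
    unfold g
    rw [Finset.sum_div, Finset.sum_mul]
    apply Finset.sum_congr rfl
    intro z hz
    rw [Φ.C_eq hz]
    ring
  rw [Finset.sum_congr rfl h1, Finset.sum_comm]
  apply Finset.sum_congr rfl
  intro z hz
  have h2 : ∀ y ∈ Q, (if z ∈ Φ.C f lam' y then f z * (T.w z : ℂ) * (T.w y : ℂ) / (T.wS (Φ.C f lam' z) : ℂ) else 0)
      = (if y ∈ Φ.C f lam' z then f z * (T.w z : ℂ) * (T.w y : ℂ) / (T.wS (Φ.C f lam' z) : ℂ) else 0) := by
    intro y _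
    simp only [hsymm y z]
  rw [Finset.sum_congr rfl h2, ← Finset.sum_filter, Finset.filter_mem_eq_inter,
    Finset.inter_eq_right.2 (hsub z hz), ← Finset.sum_div, ← Finset.mul_sum]
  have hw : (T.wS (Φ.C f lam' z) : ℂ) ≠ 0 := by exact_mod_cast (Φ.wC_pos hq z).ne'
  have : ∑ y ∈ Φ.C f lam' z, (T.w y : ℂ) = (T.wS (Φ.C f lam' z) : ℂ) := by
    unfold wS; push_cast; rfl
  rw [this]
  field_simp

end Filt

end HomTree

open scoped ENNReal NNReal
open MeasureTheory Filter
open HomTree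

namespace HomTree
variable {q : ℕ}

lemma zero_atom (T : HomTree q) : T.IsInftyAtom 0 :=
  ⟨⟨T.geo 0, 1, true, le_rfl, by simp⟩, by simp, by simp, by simp⟩

lemma H1Norm_le (T : HomTree q) {ι : Type*} [Countable ι] (h : T.V → ℂ) (c : ι → ℂ)
    (a : ι → T.V → ℂ) (ha : ∀ i, T.IsInftyAtom (a i))
    (hs : ∀ x, HasSum (fun i => c i * a i x) (h x)) :
    T.H1Norm h ≤ ∑' i, (‖c i‖₊ : ℝ≥0∞) := by
  obtain ⟨e, he⟩ := Countable.exists_injective_nat ι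
  have key : T.H1Norm h ≤ ∑' n, (‖Function.extend e c 0 n‖₊ : ℝ≥0∞) := by
    unfold H1Norm
    refine iInf_le_of_le (Function.extend e c 0) (iInf_le_of_le (Function.extend e a 0)
      (iInf_le_of_le ⟨?_, ?_⟩ le_rfl))
    · intro n
      by_cases hn : ∃ i, e i = n
      · obtain ⟨i, rfl⟩ := hn
        rw [he.extend_apply]; exact ha i
      · rw [Function.extend_apply' _ _ _ hn]; exact T.zero_atom
    · intro x
      have : (fun i => c i * a i x) =
          (fun n => Function.extend e c 0 n * Function.extend e a 0 n x) ∘ e := by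
        funext i
        simp [he.extend_apply]
      rw [← he.hasSum_iff, ← this]
      · exact hs x
      · intro n hn
        have : ¬ ∃ i, e i = n := hn
        rw [Function.extend_apply' _ _ _ this]; simp
  refine key.trans (le_of_eq ?_)
  rw [← he.tsum_eq]
  · simp [he.extend_apply]
  · intro n hn
    by_contra hcon
    apply hn
    have : ¬ ∃ i, e i = n := hcon
    beta_reduce
    rw [Function.extend_apply' _ _ _ this]; simp

/-- Normalising a bounded mean zero function on a cell to an atom. -/
lemma mk_atom (T : HomTree q) (hq : 2 ≤ q) (F : Finset T.V) (hF : F.Nonempty)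
    (henv : ∃ R : T.Trapezoid, (F : Set T.V) ⊆ R.envelope ∧
      T.mu R.envelope ≤ ENNReal.ofReal (8 * T.wS F)) (a : T.V → ℂ) (M : ℝ) (hM : 0 < M)
    (hsupp : ∀ x, x ∉ F → a x = 0) (hb : ∀ x, ‖a x‖ ≤ M)
    (hz : ∑ x ∈ F, a x * (T.w x : ℂ) = 0) :
    T.IsInftyAtom (fun x => a x / ((8 * M * T.wS F : ℝ) : ℂ)) := by
  obtain ⟨R, h1, h2⟩ := henv
  have hw := T.wS_pos hq hF
  refine ⟨R, ?_, ?_, ?_⟩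
  · intro x hx
    apply h1
    by_contra hcon
    apply hx
    simp [hsupp x hcon]
  · intro x
    refine le_trans ?_ (ENNReal.inv_le_inv.2 h2)
    rw [← ENNReal.ofReal_inv_of_pos (by positivity), ← ENNReal.ofReal_coe_nnreal, coe_nnnorm]
    apply ENNReal.ofReal_le_ofReal
    rw [norm_div, Complex.norm_real, Real.norm_of_nonneg (by positivity), div_le_iff₀ (by positivity)]
    have := hb x
    calc ‖a x‖ ≤ M := this
      _ = _ := by field_simp
  · rw [tsum_eq_sum (s := F)]
    · have : ∀ x ∈ F, a x / ((8 * M * T.wS F : ℝ) : ℂ) * (q : ℂ) ^ T.lev x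
          = (a x * (T.w x : ℂ)) / ((8 * M * T.wS F : ℝ) : ℂ) := by
        intro x _
        have : (T.w x : ℂ) = (q : ℂ) ^ T.lev x := by unfold w; push_cast; rfl
        rw [this]; ring
      rw [Finset.sum_congr rfl this, ← Finset.sum_div, hz, zero_div]
    · intro x hx
      simp [hsupp x hx]

namespace Filt

variable {T : HomTree q} {s : ℤ} (Φ : T.Filt s) (f : T.V → ℂ)

/-- The family of stopping cells. -/
def QQ (lam : ℝ) : Set (Finset T.V) := {Q | ∃ x ∈ Φ.E f lam, Φ.C f lam x = Q}

variable {f} {lam : ℝ}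

lemma QQ_eq {Q : Finset T.V} (h : Q ∈ Φ.QQ f lam) {y : T.V} (hy : y ∈ Q) :
    y ∈ Φ.E f lam ∧ Φ.C f lam y = Q := by
  obtain ⟨x, hx, rfl⟩ := h
  exact ⟨Φ.mem_E_of hx hy, Φ.C_eq hy⟩

open Classical in
lemma sum_QQ (hq : 2 ≤ q) (hl : 0 < lam) :
    ∑' Q : Finset T.V, (if Q ∈ Φ.QQ f lam then ENNReal.ofReal (lam * T.wS Q) else 0)
      ≤ 2 * ∑' x, ENNReal.ofReal (T.hh f lam x) := by
  calc ∑' Q : Finset T.V, (if Q ∈ Φ.QQ f lam then ENNReal.ofReal (lam * T.wS Q) else 0)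
      ≤ ∑' Q : Finset T.V, ∑' y : T.V,
          (if Q ∈ Φ.QQ f lam ∧ y ∈ Q then 2 * ENNReal.ofReal (T.hh f lam y) else 0) := by
        apply ENNReal.tsum_le_tsum
        intro Q
        split_ifs with h
        · obtain ⟨x, hx, rfl⟩ := h
          have h1 := Φ.weak_cell hq hl hx
          have h2 : Φ.C f lam x ∈ Φ.QQ f lam := ⟨x, hx, rfl⟩
          simp only [h2, true_and]
          rw [tsum_eq_sum (s := Φ.C f lam x)]
          · refine (ENNReal.ofReal_le_ofReal h1).trans (le_of_eq ?_)
            rw [ENNReal.ofReal_mul (by norm_num), ENNReal.ofReal_sum_of_nonneg, Finset.mul_sum]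
            · apply Finset.sum_congr rfl
              intro y hy
              rw [if_pos hy]; simp
            · exact fun y _ => T.hh_nonneg hq f lam y
          · intro y hy; rw [if_neg hy]
        · exact zero_le
    _ = ∑' y : T.V, ∑' Q : Finset T.V,
          (if Q ∈ Φ.QQ f lam ∧ y ∈ Q then 2 * ENNReal.ofReal (T.hh f lam y) else 0) :=
        ENNReal.tsum_comm
    _ ≤ ∑' y : T.V, 2 * ENNReal.ofReal (T.hh f lam y) := by
        apply ENNReal.tsum_le_tsum
        intro y
        rw [tsum_eq_single (Φ.C f lam y)]
        · split_ifs
          · exact le_rfl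
          · exact zero_le
        · intro Q hQ
          rw [if_neg]
          rintro ⟨h1, h2⟩
          exact hQ (Φ.QQ_eq h1 h2).2.symm
    _ = _ := ENNReal.tsum_mul_left

open Classical in
lemma sum_E (hq : 2 ≤ q) (hl : 0 < lam) :
    ∑' x : T.V, (if x ∈ Φ.E f lam then ENNReal.ofReal (lam * T.w x) else 0)
      ≤ 2 * ∑' x, ENNReal.ofReal (T.hh f lam x) := by
  refine le_trans ?_ (Φ.sum_QQ hq hl)
  calc ∑' x : T.V, (if x ∈ Φ.E f lam then ENNReal.ofReal (lam * T.w x) else 0)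
      ≤ ∑' x : T.V, ∑' Q : Finset T.V,
        (if Q ∈ Φ.QQ f lam ∧ x ∈ Q then ENNReal.ofReal (lam * T.w x) else 0) := by
        apply ENNReal.tsum_le_tsum
        intro x
        split_ifs with h
        · refine le_trans ?_ (ENNReal.le_tsum (Φ.C f lam x))
          rw [if_pos ⟨⟨x, h, rfl⟩, Φ.C_self x⟩]
        · exact zero_le
    _ = ∑' Q : Finset T.V, ∑' x : T.V,
        (if Q ∈ Φ.QQ f lam ∧ x ∈ Q then ENNReal.ofReal (lam * T.w x) else 0) := ENNReal.tsum_comm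
    _ ≤ _ := by
        apply ENNReal.tsum_le_tsum
        intro Q
        split_ifs with h
        · simp only [h, true_and]
          rw [tsum_eq_sum (s := Q)]
          · unfold wS
            rw [Finset.mul_sum, ENNReal.ofReal_sum_of_nonneg]
            · apply Finset.sum_le_sum
              intro y hy
              rw [if_pos hy]
            · exact fun y _ => mul_nonneg hl.le (T.w_pos hq y).le
          · intro y hy; rw [if_neg hy]
        · simp [h]

open Classical in
/-- The atomic decomposition of the bad part. -/
lemma H1_bad (hq : 2 ≤ q) (hl : 0 < lam) (htop : ∀ x, ¬ Φ.bad f lam 0 x) :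
    T.H1Norm (fun x => f x - Φ.g f lam x) ≤
      ENNReal.ofReal (48 * q) * ∑' j : ℕ, ∑' x, ENNReal.ofReal (T.hh f (lam * 2 ^ j) x) := by
  have hcount := T.countable_V
  have hq2 : (2:ℝ) ≤ q := by exact_mod_cast hq
  set lj : ℕ → ℝ := fun j => lam * 2 ^ j with hlj
  have hljpos : ∀ j, 0 < lj j := fun j => by simp only [hlj]; positivity
  have hljmono : ∀ j, lj j ≤ lj (j+1) := fun j => by
    have := hljpos j
    have : lj (j+1) = 2 * lj j := by simp only [hlj, pow_succ]; ring
    linarith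
  have hljm : Monotone lj := monotone_nat_of_le_succ hljmono
  have hl0 : lj 0 = lam := by simp [hlj]
  have htopj : ∀ j x, ¬ Φ.bad f (lj j) 0 x := by
    intro j x hb
    refine htop x (lt_of_le_of_lt (mul_le_mul_of_nonneg_right ?_ (T.wS_nonneg hq _)) hb)
    rw [← hl0]; exact hljm (Nat.zero_le j)
  set D : ℕ → T.V → ℂ := fun j x => Φ.g f (lj (j+1)) x - Φ.g f (lj j) x with hD
  have hDb : ∀ j x, ‖D j x‖ ≤ 3 * q * lj j := by
    intro j x
    have h1 := Φ.g_bound hq (hljpos j) (htopj j) x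
    have h2 := Φ.g_bound hq (hljpos (j+1)) (htopj (j+1)) x
    have h3 : lj (j+1) = 2 * lj j := by simp only [hlj, pow_succ]; ring
    rw [h3] at h2
    calc _ ≤ ‖Φ.g f (lj (j+1)) x‖ + ‖Φ.g f (lj j) x‖ := norm_sub_le _ _
      _ ≤ _ := by rw [h3]; linarith
  let c : ℕ × Finset T.V → ℂ := fun i =>
    if i.2 ∈ Φ.QQ f (lj i.1) then ((8 * (3 * q * lj i.1) * T.wS i.2 : ℝ) : ℂ) else 0
  let a : ℕ × Finset T.V → T.V → ℂ := fun i x =>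
    if i.2 ∈ Φ.QQ f (lj i.1) then
      (if x ∈ i.2 then D i.1 x else 0) / ((8 * (3 * q * lj i.1) * T.wS i.2 : ℝ) : ℂ) else 0
  have hatom : ∀ i, T.IsInftyAtom (a i) := by
    rintro ⟨j, Q⟩
    by_cases h : Q ∈ Φ.QQ f (lj j)
    · simp only [a, if_pos h]
      obtain ⟨x, hx, hxQ⟩ := h
      have hne : Q.Nonempty := ⟨x, hxQ ▸ Φ.C_self x⟩
      have hlp := hljpos j
      apply T.mk_atom hq Q hne _ (fun x => if x ∈ Q then D j x else 0) (3 * q * lj j) (by positivity)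
      · intro x hx; simp [hx]
      · intro x
        split_ifs
        · exact hDb j x
        · rw [norm_zero]; positivity
      · have : ∀ x ∈ Q, (if x ∈ Q then D j x else 0) * (T.w x : ℂ)
            = Φ.g f (lj (j+1)) x * (T.w x : ℂ) - Φ.g f (lj j) x * (T.w x : ℂ) := by
          intro x hx
          rw [if_pos hx]; simp only [hD]; ring
        rw [Finset.sum_congr rfl this, Finset.sum_sub_distrib, ← hxQ,
          Φ.sum_g hq (hljmono j), Φ.sum_g hq le_rfl, sub_self]
      · obtain ⟨n, h1, _⟩ := Φ.exists_bad hx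
        rw [← hxQ, h1]
        exact Φ.env n x
    · have : a (j, Q) = 0 := by
        funext x; simp only [a, if_neg h]; rfl
      rw [this]; exact T.zero_atom
  have hsum : ∀ x, HasSum (fun i => c i * a i x) (f x - Φ.g f lam x) := by
    intro x
    have hterm : ∀ j Q, c (j, Q) * a (j, Q) x =
        if Q ∈ Φ.QQ f (lj j) ∧ x ∈ Q then D j x else 0 := by
      intro j Q
      simp only [c, a]
      by_cases h : Q ∈ Φ.QQ f (lj j)
      · by_cases h' : x ∈ Q
        · simp only [h, h', if_true, and_true]
          have hw := T.wS_pos hq ⟨x, h'⟩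
          have hlp := hljpos j
          have : ((8 * (3 * q * lj j) * T.wS Q : ℝ) : ℂ) ≠ 0 := by
            rw [Complex.ofReal_ne_zero]; positivity
          rw [mul_div_assoc', mul_div_cancel_left₀ _ this]
        · simp [h']
      · simp [h]
    obtain ⟨J, hJ⟩ : ∃ J, ∀ j, J ≤ j → x ∉ Φ.E f (lj j) := by
      obtain ⟨N, hN⟩ := Φ.fin x
      have hstab : ∀ n, N ≤ n → Φ.S n x = {x} := by
        intro n hn
        apply Finset.Subset.antisymm
        · rw [← hN]; exact Φ.S_mono hn x
        · simpa using Φ.self n x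
      set B := ∑ n ∈ Finset.range (N+1), T.fS f (Φ.S n x) / T.wS (Φ.S n x) with hB
      have hnn : ∀ n, 0 ≤ T.fS f (Φ.S n x) / T.wS (Φ.S n x) := fun n =>
        div_nonneg (Finset.sum_nonneg fun y _ => mul_nonneg (norm_nonneg _) (T.w_pos hq y).le)
          (T.wS_nonneg hq _)
      have hall : ∀ n, T.fS f (Φ.S n x) / T.wS (Φ.S n x) ≤ B := by
        intro n
        by_cases hn : n ≤ N
        · exact Finset.single_le_sum (f := fun n => T.fS f (Φ.S n x) / T.wS (Φ.S n x))
            (fun n _ => hnn n) (Finset.mem_range.2 (by omega))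
        · rw [hstab n (by omega), ← hN]
          exact Finset.single_le_sum (f := fun n => T.fS f (Φ.S n x) / T.wS (Φ.S n x))
            (fun n _ => hnn n) (Finset.mem_range.2 (by omega))
      obtain ⟨J, hJ⟩ := pow_unbounded_of_one_lt (B / lam) (by norm_num : (1:ℝ) < 2)
      refine ⟨J, ?_⟩
      rintro j hj ⟨n, hn⟩
      unfold bad at hn
      rw [← lt_div_iff₀ (T.wS_pos hq ⟨x, Φ.self n x⟩)] at hn
      rw [div_lt_iff₀ hl] at hJ
      have h1 := hall n
      have h2 := hljm hj
      have h3 : lj J = 2 ^ J * lam := by simp only [hlj]; ring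
      linarith
    have htel : ∑ j ∈ Finset.range J, D j x = f x - Φ.g f lam x := by
      simp only [hD]
      rw [Finset.sum_range_sub (fun j => Φ.g f (lj j) x), hl0, Φ.g_of_not hq (hJ J le_rfl)]
    rw [← htel]
    have hD0 : ∀ j, x ∉ Φ.E f (lj j) → D j x = 0 := by
      intro j hj
      simp only [hD]
      rw [Φ.g_of_not hq hj, Φ.g_of_not hq (fun h => hj (Φ.E_anti hq (hljmono j) h)), sub_self]
    have himg : ∑ j ∈ Finset.range J, D j x =
        ∑ i ∈ (Finset.range J).image (fun j => (j, Φ.C f (lj j) x)), c i * a i x := by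
      rw [Finset.sum_image]
      · apply Finset.sum_congr rfl
        intro j _
        rw [hterm]
        split_ifs with h
        · rfl
        · apply hD0
          intro hx
          exact h ⟨⟨x, hx, rfl⟩, Φ.C_self x⟩
      · intro j _ j' _ h
        exact (Prod.mk.inj h).1
    rw [himg]
    apply hasSum_sum_of_ne_finset_zero
    rintro ⟨j, Q⟩ hi
    rw [hterm]
    rw [if_neg]
    rintro ⟨h1, h2⟩
    obtain ⟨h3, h4⟩ := Φ.QQ_eq h1 h2
    apply hi
    rw [Finset.mem_image]
    refine ⟨j, ?_, by rw [h4]⟩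
    rw [Finset.mem_range]
    by_contra! hcon
    exact hJ j hcon h3
  refine (T.H1Norm_le _ c a hatom hsum).trans ?_
  rw [ENNReal.tsum_prod', ← ENNReal.tsum_mul_left]
  apply ENNReal.tsum_le_tsum
  intro j
  calc ∑' Q, (‖c (j, Q)‖₊ : ℝ≥0∞)
      = ∑' Q, ENNReal.ofReal (24 * q) *
        (if Q ∈ Φ.QQ f (lj j) then ENNReal.ofReal (lj j * T.wS Q) else 0) := by
        congr 1
        funext Q
        simp only [c]
        split_ifs with h
        · have := hljpos j
          have := T.wS_nonneg hq Q
          rw [← ENNReal.ofReal_mul (by positivity), ← ENNReal.ofReal_coe_nnreal, coe_nnnorm,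
            Complex.norm_real, Real.norm_of_nonneg (by positivity)]
          congr 1; ring
        · simp
    _ ≤ ENNReal.ofReal (24 * q) * (2 * ∑' x, ENNReal.ofReal (T.hh f (lj j) x)) := by
        rw [ENNReal.tsum_mul_left]
        gcongr
        exact Φ.sum_QQ hq (hljpos j)
    _ = _ := by
        rw [← mul_assoc]
        congr 1
        have : (2:ℝ≥0∞) = ENNReal.ofReal 2 := by simp
        rw [this, ← ENNReal.ofReal_mul (by positivity)]
        congr 1; ring

end Filt

lemma nnn (z : ℂ) : (‖z‖₊ : ℝ≥0∞) = ENNReal.ofReal ‖z‖ := by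
  rw [← ENNReal.ofReal_coe_nnreal, coe_nnnorm]

lemma lpPow_eq (T : HomTree q) (hq : 2 ≤ q) (f : T.V → ℂ) (p : ℝ) (hp : 0 ≤ p) :
    T.lpPow f p = ∑' x, ENNReal.ofReal (‖f x‖ ^ p * T.w x) := by
  unfold lpPow
  congr 1; funext x
  rw [nnn, ENNReal.ofReal_rpow_of_nonneg (norm_nonneg _) hp, ← T.ofReal_w hq,
    ENNReal.ofReal_mul (by positivity)]

open Classical in
/-- Calderon-Zygmund decomposition at height `lam`, bad part controlled in `H¹`. -/
theorem cz (T : HomTree q) (hq : 2 ≤ q) (p : ℝ) (hp : 1 < p) (f : T.V → ℂ)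
    (hf : T.lpPow f p ≠ ⊤) (lam : ℝ) (hl : 0 < lam) :
    ∃ (g : T.V → ℂ) (E : Set T.V), (∀ x, ‖g x‖ ≤ q * lam) ∧
      (∀ x, x ∉ E → g x = f x ∧ ‖f x‖ ≤ lam) ∧
      ∑' x : T.V, (if x ∈ E then ENNReal.ofReal (lam * T.w x) else 0)
        ≤ 2 * ∑' x, ENNReal.ofReal (T.hh f lam x) ∧
      T.H1Norm (fun x => f x - g x) ≤
        ENNReal.ofReal (48 * q) * ∑' j : ℕ, ∑' x, ENNReal.ofReal (T.hh f (lam * 2 ^ j) x) := by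
  rw [T.lpPow_eq hq f p (by linarith)] at hf
  set B := (∑' x, ENNReal.ofReal (‖f x‖ ^ p * T.w x)).toReal with hB
  have hpB : ∀ F : Finset T.V, ∑ x ∈ F, ‖f x‖ ^ p * T.w x ≤ B := by
    intro F
    have h1 := ENNReal.sum_le_tsum (f := fun x => ENNReal.ofReal (‖f x‖ ^ p * T.w x)) F
    have hnn : ∀ x ∈ F, 0 ≤ ‖f x‖ ^ p * T.w x := fun x _ =>
      mul_nonneg (by positivity) (T.w_pos hq x).le
    rw [← ENNReal.ofReal_sum_of_nonneg hnn] at h1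
    have h2 := ENNReal.toReal_mono hf h1
    rwa [ENNReal.toReal_ofReal (Finset.sum_nonneg hnn)] at h2
  have hq1 : (1:ℝ) < q := by exact_mod_cast (by omega : 1 < q)
  obtain ⟨n, hn⟩ := pow_unbounded_of_one_lt ((lam / 2) ^ (1 - p) * B / (lam / 2)) hq1
  let Φ := T.filt hq (n : ℤ)
  have htop : ∀ x, ¬ Φ.bad f lam 0 x := by
    intro x
    unfold Filt.bad
    rw [not_lt]
    have h1 := T.fS_le_hh hq f lam hl (Φ.S 0 x)
    have h2 : (q:ℝ) ^ (n:ℤ) ≤ T.wS (Φ.S 0 x) := Φ.top x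
    rw [zpow_natCast] at h2
    have h3 : ∑ y ∈ Φ.S 0 x, T.hh f lam y ≤ (lam / 2) ^ (1 - p) * B := by
      refine le_trans ?_ (mul_le_mul_of_nonneg_left (hpB (Φ.S 0 x)) (by positivity))
      rw [Finset.mul_sum]
      apply Finset.sum_le_sum
      intro y _
      have hw := T.w_pos hq y
      unfold hh
      split_ifs with h
      · rw [← mul_assoc]
        apply mul_le_mul_of_nonneg_right _ hw.le
        have hpos : 0 < ‖f y‖ := by linarith [half_pos hl]
        have h4 : ‖f y‖ ^ (1 - p) ≤ (lam / 2) ^ (1 - p) :=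
          Real.rpow_le_rpow_of_nonpos (by positivity) h.le (by linarith)
        calc ‖f y‖ = ‖f y‖ ^ (1 - p) * ‖f y‖ ^ p := by
              rw [← Real.rpow_add hpos]; simp
          _ ≤ _ := by gcongr
      · positivity
    rw [div_lt_iff₀ (by positivity)] at hn
    have h5 : (q:ℝ) ^ n * (lam / 2) ≤ T.wS (Φ.S 0 x) * (lam / 2) := by gcongr
    linarith
  refine ⟨Φ.g f lam, Φ.E f lam, Φ.g_bound hq hl htop,
    fun x hx => ⟨Φ.g_of_not hq hx, Φ.norm_le_of_not hq hx⟩, Φ.sum_E hq hl, Φ.H1_bad hq hl htop⟩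

end HomTree

open scoped ENNReal NNReal
open MeasureTheory Filter
open HomTree

lemma lint_pow (s a b : ℝ) (hs : 0 < s) (ha : 0 ≤ a) (hab : a ≤ b) :
    ∫⁻ t in Set.Ioc a b, ENNReal.ofReal (t ^ (s - 1)) = ENNReal.ofReal ((b ^ s - a ^ s) / s) := by
  have hi : IntervalIntegrable (fun t : ℝ => t ^ (s - 1)) volume a b :=
    intervalIntegral.intervalIntegrable_rpow' (by linarith)
  rw [← ofReal_integral_eq_lintegral_ofReal ((intervalIntegrable_iff_integrableOn_Ioc_of_le hab).1 hi)]
  · rw [← intervalIntegral.integral_of_le hab, integral_rpow (Or.inl (by linarith))]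
    simp
  · refine (ae_restrict_iff' measurableSet_Ioc).2 (Eventually.of_forall fun t ht => ?_)
    exact Real.rpow_nonneg (ha.trans ht.1.le) _

lemma amgm (d d' γ : ℝ) (hγ : 0 < γ) (hγ1 : γ ≤ 1) (hd' : 0 ≤ d') (hd : d' ≤ d) :
    γ * (d - d') ≤ d ^ (1 - γ) * (d ^ γ - d' ^ γ) := by
  have hd0 : 0 ≤ d := hd'.trans hd
  rcases eq_or_lt_of_le hd0 with h | h
  · have : d' = 0 := by linarith
    simp [← h, this]
  · have h1 := Real.geom_mean_le_arith_mean2_weighted (w₁ := 1 - γ) (w₂ := γ) (p₁ := d) (p₂ := d')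
      (by linarith) hγ.le hd0 hd' (by ring)
    have h2 : d ^ (1 - γ) * d ^ γ = d := by rw [← Real.rpow_add h]; simp
    have h3 : d ^ (1 - γ) * (d ^ γ - d' ^ γ) = d - d ^ (1 - γ) * d' ^ γ := by rw [mul_sub, h2]
    rw [h3]
    linarith

namespace HomTree
variable {q : ℕ}

lemma atom_l1 (T : HomTree q) (a : T.V → ℂ) (ha : T.IsInftyAtom a) : T.l1Norm a ≤ 1 := by
  obtain ⟨R, h1, h2, _⟩ := ha
  unfold l1Norm
  calc ∑' x : T.V, (‖a x‖₊ : ℝ≥0∞) * (q : ℝ≥0∞) ^ (T.lev x)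
      ≤ ∑' x : T.V, (T.mu R.envelope)⁻¹ * R.envelope.indicator (fun x => (q : ℝ≥0∞) ^ (T.lev x)) x := by
        apply ENNReal.tsum_le_tsum
        intro x
        by_cases hx : x ∈ R.envelope
        · rw [Set.indicator_of_mem hx]
          gcongr
          exact h2 x
        · have : a x = 0 := by
            by_contra h; exact hx (h1 h)
          simp [this]
    _ = (T.mu R.envelope)⁻¹ * T.mu R.envelope := by
        rw [ENNReal.tsum_mul_left]
        congr 1
        unfold mu
        rw [tsum_subtype R.envelope (fun x => (q : ℝ≥0∞) ^ (T.lev x))]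
    _ ≤ 1 := ENNReal.inv_mul_le_one _

lemma l1_le_H1 (T : HomTree q) (b : T.V → ℂ) : T.l1Norm b ≤ T.H1Norm b := by
  unfold H1Norm
  refine le_iInf fun c => le_iInf fun a => le_iInf fun h => ?_
  obtain ⟨ha, hs⟩ := h
  calc T.l1Norm b ≤ ∑' x : T.V, ∑' n, (‖c n‖₊ : ℝ≥0∞) * ((‖a n x‖₊ : ℝ≥0∞) * (q : ℝ≥0∞) ^ (T.lev x)) := by
        unfold l1Norm
        apply ENNReal.tsum_le_tsum
        intro x
        simp_rw [← mul_assoc]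
        rw [ENNReal.tsum_mul_right]
        gcongr
        have h1 : (‖b x‖₊ : ℝ≥0∞) = ‖∑' n, c n * a n x‖ₑ := by rw [(hs x).tsum_eq]; rfl
        rw [h1]
        refine (enorm_tsum_le_tsum_enorm).trans (le_of_eq ?_)
        congr 1; funext n
        rw [enorm_mul]; rfl
    _ = ∑' n, ∑' x : T.V, (‖c n‖₊ : ℝ≥0∞) * ((‖a n x‖₊ : ℝ≥0∞) * (q : ℝ≥0∞) ^ (T.lev x)) :=
        ENNReal.tsum_comm
    _ ≤ ∑' n, (‖c n‖₊ : ℝ≥0∞) := by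
        apply ENNReal.tsum_le_tsum
        intro n
        rw [ENNReal.tsum_mul_left]
        calc _ ≤ (‖c n‖₊ : ℝ≥0∞) * 1 := by gcongr; exact T.atom_l1 _ (ha n)
          _ = _ := mul_one _

/-- Distribution function of `f` on the finite set `F`. -/
noncomputable def dF (T : HomTree q) (F : Finset T.V) (f : T.V → ℂ) (lam : ℝ) : ℝ :=
  ∑ x ∈ F, if lam < ‖f x‖ then T.w x else 0

lemma dF_nonneg (T : HomTree q) (hq : 2 ≤ q) (F : Finset T.V) (f : T.V → ℂ) (lam : ℝ) :
    0 ≤ T.dF F f lam := by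
  apply Finset.sum_nonneg
  intro x _
  split_ifs
  · exact (T.w_pos hq x).le
  · exact le_rfl

lemma dF_cheb (T : HomTree q) (hq : 2 ≤ q) (F : Finset T.V) (f : T.V → ℂ) (lam r : ℝ)
    (hl : 0 < lam) (hr : 0 < r) :
    ENNReal.ofReal (lam ^ r * T.dF F f lam) ≤ T.lpPow f r := by
  rw [T.lpPow_eq hq f r hr.le]
  refine le_trans ?_ (ENNReal.sum_le_tsum F)
  rw [← ENNReal.ofReal_sum_of_nonneg (fun x _ => mul_nonneg (by positivity) (T.w_pos hq x).le)]
  apply ENNReal.ofReal_le_ofReal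
  unfold dF
  rw [Finset.mul_sum]
  apply Finset.sum_le_sum
  intro x _
  have := T.w_pos hq x
  split_ifs with h
  · gcongr
  · rw [mul_zero]; positivity

/-- Lower bound for the K-functional. -/
lemma K_lower (T : HomTree q) (hq : 2 ≤ q) (p₁ : ℝ≥0∞) (hp₁ : 1 < p₁) (f : T.V → ℂ) (F : Finset T.V)
    (lam t : ℝ) (hl : 0 < lam) (ht : 0 < t)
    (htd : t ≤ T.dF F f lam ^ (1 - (p₁.toReal)⁻¹)) :
    ENNReal.ofReal (lam / 4 * (t * T.dF F f lam ^ (p₁.toReal)⁻¹)) ≤ T.KH1Lp p₁ (ENNReal.ofReal t) f := by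
  set κ := (p₁.toReal)⁻¹ with hκ
  set d := T.dF F f lam with hd
  have hd0 : 0 ≤ d := T.dF_nonneg hq F f lam
  have hκ0 : 0 ≤ κ := by positivity
  have hκ1 : κ < 1 := by
    by_cases h : p₁ = ⊤
    · simp [hκ, h]
    · apply inv_lt_one_of_one_lt₀
      have := (ENNReal.toReal_lt_toReal ENNReal.one_ne_top h).2 hp₁
      simpa using this
  have hdpos : 0 < d := by
    rcases eq_or_lt_of_le hd0 with h | h
    · rw [← h, Real.zero_rpow (by linarith)] at htd; linarith
    · exact h
  have hmin : t * d ^ κ ≤ d := by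
    calc t * d ^ κ ≤ d ^ (1 - κ) * d ^ κ := by gcongr
      _ = d := by rw [← Real.rpow_add hdpos]; simp
  unfold KH1Lp
  refine le_iInf fun b => le_iInf fun g => le_iInf fun h => ?_
  have hsub : d ≤ T.dF F b (lam / 2) + T.dF F g (lam / 2) := by
    rw [hd]; unfold dF
    rw [← Finset.sum_add_distrib]
    apply Finset.sum_le_sum
    intro x _
    have hw := T.w_pos hq x
    have h1 : ‖f x‖ ≤ ‖b x‖ + ‖g x‖ := by rw [h x]; exact norm_add_le _ _
    split_ifs <;> linarith
  have hl2 : 0 < lam / 2 := by positivity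
  by_cases hb : d / 2 ≤ T.dF F b (lam / 2)
  · have h1 := T.dF_cheb hq F b (lam / 2) 1 hl2 one_pos
    have h2 : T.lpPow b 1 = T.l1Norm b := by unfold lpPow l1Norm; simp
    rw [h2] at h1
    calc ENNReal.ofReal (lam / 4 * (t * d ^ κ)) ≤ ENNReal.ofReal ((lam / 2) ^ (1:ℝ) * T.dF F b (lam / 2)) := by
          apply ENNReal.ofReal_le_ofReal
          rw [Real.rpow_one]
          calc lam / 4 * (t * d ^ κ) ≤ lam / 4 * d := by gcongr
            _ = lam / 2 * (d / 2) := by ring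
            _ ≤ _ := by gcongr
      _ ≤ T.l1Norm b := h1
      _ ≤ T.H1Norm b := T.l1_le_H1 b
      _ ≤ _ := le_self_add
  · have hg : d / 2 ≤ T.dF F g (lam / 2) := by linarith
    have key : ENNReal.ofReal (lam / 4 * d ^ κ) ≤ T.lpNormE p₁ g := by
      unfold lpNormE
      split_ifs with htop
      · have hκz : κ = 0 := by simp [hκ, htop]
        rw [hκz, Real.rpow_zero, mul_one]
        obtain ⟨x, hx⟩ : ∃ x, lam / 2 < ‖g x‖ := by
          by_contra! hcon
          have : T.dF F g (lam / 2) = 0 := by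
            unfold dF
            apply Finset.sum_eq_zero
            intro x _
            rw [if_neg (not_lt.2 (hcon x))]
          linarith
        refine le_trans ?_ (le_iSup _ x)
        rw [nnn]
        apply ENNReal.ofReal_le_ofReal
        linarith
      · set r := p₁.toReal with hr
        have hrpos : 0 < r := ENNReal.toReal_pos (by rintro rfl; simp at hp₁) htop
        have h1 := T.dF_cheb hq F g (lam / 2) r hl2 hrpos
        refine le_trans ?_ (ENNReal.rpow_le_rpow h1 (by positivity : 0 ≤ r⁻¹))
        have hgnn := T.dF_nonneg hq F g (lam / 2)
        rw [ENNReal.ofReal_rpow_of_nonneg (by positivity) (by positivity)]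
        apply ENNReal.ofReal_le_ofReal
        rw [Real.mul_rpow (by positivity) hgnn, ← Real.rpow_mul (by positivity),
          mul_inv_cancel₀ hrpos.ne', Real.rpow_one]
        calc lam / 4 * d ^ κ = lam / 2 * (d ^ κ / 2) := by ring
          _ ≤ lam / 2 * (d / 2) ^ κ := by
              gcongr
              rw [Real.div_rpow hd0 (by norm_num)]
              gcongr
              calc (2:ℝ) ^ κ ≤ 2 ^ (1:ℝ) := by
                    apply Real.rpow_le_rpow_of_exponent_le (by norm_num) hκ1.le
                _ = 2 := by simp
          _ ≤ _ := by gcongr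
    calc ENNReal.ofReal (lam / 4 * (t * d ^ κ)) = ENNReal.ofReal t * ENNReal.ofReal (lam / 4 * d ^ κ) := by
          rw [← ENNReal.ofReal_mul ht.le]; congr 1; ring
      _ ≤ ENNReal.ofReal t * T.lpNormE p₁ g := by gcongr
      _ ≤ _ := le_add_self

end HomTree

open scoped ENNReal NNReal
open MeasureTheory Filter
open HomTree

lemma integrand_eq (A t θ p : ℝ) (hA : 0 ≤ A) (ht : 0 < t) (hp : 0 < p) :
    (ENNReal.ofReal (A * t) / (ENNReal.ofReal t) ^ θ) ^ p * (ENNReal.ofReal t)⁻¹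
      = ENNReal.ofReal (A ^ p * t ^ (p * (1 - θ) - 1)) := by
  rw [ENNReal.ofReal_rpow_of_pos ht, ← ENNReal.ofReal_div_of_pos (by positivity),
    ENNReal.ofReal_rpow_of_nonneg (by positivity) hp.le, ← ENNReal.ofReal_inv_of_pos ht,
    ← ENNReal.ofReal_mul (by positivity)]
  congr 1
  rw [mul_div_assoc, Real.mul_rpow hA (by positivity), mul_assoc]
  congr 1
  have h1 : t / t ^ θ = t ^ (1 - θ) := by rw [Real.rpow_sub ht, Real.rpow_one]
  rw [h1, ← Real.rpow_mul ht.le, Real.rpow_sub ht, Real.rpow_one, mul_comm p, div_eq_mul_inv]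

namespace HomTree
variable {q : ℕ}

/-- The `p`-th power of the interpolation norm. -/
noncomputable def II (T : HomTree q) (p₁ : ℝ≥0∞) (θ pr : ℝ) (f : T.V → ℂ) : ℝ≥0∞ :=
  ∫⁻ t in Set.Ioi (0 : ℝ),
      (T.KH1Lp p₁ (ENNReal.ofReal t) f / (ENNReal.ofReal t) ^ θ) ^ pr *
        (ENNReal.ofReal t)⁻¹

lemma dF_antitone (T : HomTree q) (hq : 2 ≤ q) (F : Finset T.V) (f : T.V → ℂ) :
    Antitone (T.dF F f) := by
  intro a b hab
  unfold dF
  apply Finset.sum_le_sum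
  intro x _
  have := T.w_pos hq x
  split_ifs <;> linarith

lemma lower_piece (T : HomTree q) (hq : 2 ≤ q) (p κ θ : ℝ) (p₁ : ℝ≥0∞) (hp : 1 < p)
    (hp₁ : 1 < p₁) (hκ : κ = (p₁.toReal)⁻¹) (hκ0 : 0 ≤ κ) (hκp : κ * p < 1) (hκ1 : κ < 1)
    (hθ1 : θ < 1) (hrel : p * (1 - θ) * (1 - κ) = 1 - κ * p)
    (f : T.V → ℂ) (F : Finset T.V) (lam : ℝ) (hl : 0 < lam) :
    ENNReal.ofReal (2 ^ p * lam ^ p * (T.dF F f lam - T.dF F f (2 * lam))) ≤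
      ENNReal.ofReal (2 ^ p * 4 ^ p * (p * (1 - θ)) / (1 - κ * p)) *
      ∫⁻ t in Set.Ioc (T.dF F f (2 * lam) ^ (1 - κ)) (T.dF F f lam ^ (1 - κ)),
      (T.KH1Lp p₁ (ENNReal.ofReal t) f / (ENNReal.ofReal t) ^ θ) ^ p *
        (ENNReal.ofReal t)⁻¹ := by
  set d := T.dF F f lam with hd
  set d' := T.dF F f (2 * lam) with hd'
  have hd0 : 0 ≤ d := T.dF_nonneg hq F f _
  have hd'0 : 0 ≤ d' := T.dF_nonneg hq F f _
  have hdd : d' ≤ d := T.dF_antitone hq F f (by linarith)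
  have hs : 0 < p * (1 - θ) := mul_pos (by linarith) (by linarith)
  set s := p * (1 - θ) with hsdef
  set γ := 1 - κ * p with hγ
  have hγ0 : 0 < γ := by linarith
  have hp0 : 0 < p := by linarith
  have hγ1 : γ ≤ 1 := by have := mul_nonneg hκ0 hp0.le; linarith
  have hmono : d' ^ (1 - κ) ≤ d ^ (1 - κ) := Real.rpow_le_rpow hd'0 hdd (by linarith)
  have step : ENNReal.ofReal ((lam / 4 * d ^ κ) ^ p) *
      ENNReal.ofReal (((d ^ (1 - κ)) ^ s - (d' ^ (1 - κ)) ^ s) / s) ≤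
      ∫⁻ t in Set.Ioc (d' ^ (1 - κ)) (d ^ (1 - κ)),
      (T.KH1Lp p₁ (ENNReal.ofReal t) f / (ENNReal.ofReal t) ^ θ) ^ p *
        (ENNReal.ofReal t)⁻¹ := by
    rw [← lint_pow s _ _ hs (by positivity) hmono, ← lintegral_const_mul _ (by fun_prop)]
    refine setLIntegral_mono' measurableSet_Ioc fun t ht => ?_
    have ht0 : 0 < t := lt_of_le_of_lt (by positivity) ht.1
    rw [← ENNReal.ofReal_mul (by positivity), hsdef, ← integrand_eq _ t θ p (by positivity) ht0 hp0]
    gcongr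
    have := T.K_lower hq p₁ hp₁ f F lam t hl ht0 (by rw [← hκ]; exact ht.2)
    rw [← hκ] at this
    refine le_trans (le_of_eq ?_) this
    congr 1; ring
  refine le_trans ?_ (mul_le_mul_right step _)
  rw [← ENNReal.ofReal_mul (by positivity), ← ENNReal.ofReal_mul (by positivity)]
  apply ENNReal.ofReal_le_ofReal
  have e1 : (d ^ (1 - κ)) ^ s = d ^ γ := by rw [← Real.rpow_mul hd0, mul_comm, hrel]
  have e2 : (d' ^ (1 - κ)) ^ s = d' ^ γ := by rw [← Real.rpow_mul hd'0, mul_comm, hrel]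
  have e3 : (lam / 4 * d ^ κ) ^ p = lam ^ p / 4 ^ p * d ^ (1 - γ) := by
    rw [Real.mul_rpow (by positivity) (by positivity), Real.div_rpow hl.le (by norm_num),
      ← Real.rpow_mul hd0]
    congr 2; rw [hγ]; ring
  rw [e1, e2, e3]
  have h4 : (0:ℝ) < 4 ^ p := by positivity
  have : 2 ^ p * 4 ^ p * s / γ * (lam ^ p / 4 ^ p * d ^ (1 - γ) * ((d ^ γ - d' ^ γ) / s))
     = 2 ^ p * lam ^ p * ((d ^ (1 - γ) * (d ^ γ - d' ^ γ)) / γ) := by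
    field_simp
  rw [this]
  gcongr
  rw [le_div_iff₀ hγ0, mul_comm]
  exact amgm d d' γ hγ0 hγ1 hd'0 hdd

theorem lower (T : HomTree q) (hq : 2 ≤ q) (p κ θ : ℝ) (p₁ : ℝ≥0∞) (hp : 1 < p)
    (hp₁ : 1 < p₁) (hκ : κ = (p₁.toReal)⁻¹) (hκ0 : 0 ≤ κ) (hκp : κ * p < 1) (hκ1 : κ < 1)
    (hθ1 : θ < 1) (hrel : p * (1 - θ) * (1 - κ) = 1 - κ * p)
    (f : T.V → ℂ) :
    T.lpPow f p ≤ ENNReal.ofReal (2 ^ p * 4 ^ p * (p * (1 - θ)) / (1 - κ * p)) * T.II p₁ θ p f := by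
  have hp0 : 0 < p := by linarith
  rw [T.lpPow_eq hq f p hp0.le, ENNReal.tsum_eq_iSup_sum]
  refine iSup_le fun F => ?_
  have hpt : ∀ x : T.V, ENNReal.ofReal (‖f x‖ ^ p * T.w x) ≤
      ∑' k : ℤ, ENNReal.ofReal (2 ^ p * ((2:ℝ) ^ k) ^ p *
        ((if (2:ℝ) ^ k < ‖f x‖ then T.w x else 0) - (if 2 * (2:ℝ) ^ k < ‖f x‖ then T.w x else 0))) := by
    intro x
    have hw := T.w_pos hq x
    rcases eq_or_lt_of_le (norm_nonneg (f x)) with h | h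
    · rw [← h, Real.zero_rpow hp0.ne']; simp
    · obtain ⟨k, hk1, hk2⟩ := exists_mem_Ioc_zpow h (by norm_num : (1:ℝ) < 2)
      refine le_trans ?_ (ENNReal.le_tsum k)
      apply ENNReal.ofReal_le_ofReal
      rw [zpow_add_one₀ (by norm_num)] at hk2
      rw [if_pos hk1, if_neg (by linarith), sub_zero, ← Real.mul_rpow (by norm_num) (by positivity)]
      gcongr
      linarith
  set t : ℤ → ℝ := fun k => T.dF F f ((2:ℝ) ^ k) ^ (1 - κ) with ht
  have htanti : Antitone t := by
    intro a b hab
    apply Real.rpow_le_rpow (T.dF_nonneg hq F f _) _ (by linarith)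
    apply T.dF_antitone hq F f
    exact zpow_le_zpow_right₀ (by norm_num) hab
  calc ∑ x ∈ F, ENNReal.ofReal (‖f x‖ ^ p * T.w x) ≤ ∑ x ∈ F, ∑' k : ℤ, ENNReal.ofReal (2 ^ p * ((2:ℝ) ^ k) ^ p *
        ((if (2:ℝ) ^ k < ‖f x‖ then T.w x else 0) - (if 2 * (2:ℝ) ^ k < ‖f x‖ then T.w x else 0))) :=
        Finset.sum_le_sum fun x _ => hpt x
    _ = ∑' k : ℤ, ∑ x ∈ F, ENNReal.ofReal (2 ^ p * ((2:ℝ) ^ k) ^ p *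
        ((if (2:ℝ) ^ k < ‖f x‖ then T.w x else 0) - (if 2 * (2:ℝ) ^ k < ‖f x‖ then T.w x else 0))) :=
        (Summable.tsum_finsetSum fun _ _ => ENNReal.summable).symm
    _ = ∑' k : ℤ, ENNReal.ofReal (2 ^ p * ((2:ℝ) ^ k) ^ p * (T.dF F f ((2:ℝ) ^ k) - T.dF F f (2 * (2:ℝ) ^ k))) := by
        congr 1; funext k
        rw [← ENNReal.ofReal_sum_of_nonneg]
        · unfold dF
          rw [← Finset.sum_sub_distrib, Finset.mul_sum]
        · intro x _
          have hw := T.w_pos hq x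
          have h2 : (0:ℝ) < 2 ^ k := by positivity
          apply mul_nonneg (by positivity)
          split_ifs <;> linarith
    _ ≤ ∑' k : ℤ, ENNReal.ofReal (2 ^ p * 4 ^ p * (p * (1 - θ)) / (1 - κ * p)) *
      ∫⁻ t in Set.Ioc (t (k + 1)) (t k),
      (T.KH1Lp p₁ (ENNReal.ofReal t) f / (ENNReal.ofReal t) ^ θ) ^ p *
        (ENNReal.ofReal t)⁻¹ := by
        apply ENNReal.tsum_le_tsum
        intro k
        have := T.lower_piece hq p κ θ p₁ hp hp₁ hκ hκ0 hκp hκ1 hθ1 hrel f F ((2:ℝ) ^ k) (by positivity)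
        have e : (2:ℝ) ^ (k + 1) = 2 * 2 ^ k := by rw [zpow_add_one₀ (by norm_num)]; ring
        simp only [ht, e]
        exact this
    _ = ENNReal.ofReal (2 ^ p * 4 ^ p * (p * (1 - θ)) / (1 - κ * p)) *
      ∫⁻ t in ⋃ k : ℤ, Set.Ioc (t (k + 1)) (t k),
      (T.KH1Lp p₁ (ENNReal.ofReal t) f / (ENNReal.ofReal t) ^ θ) ^ p *
        (ENNReal.ofReal t)⁻¹ := by
        rw [ENNReal.tsum_mul_left, lintegral_iUnion (fun _ => measurableSet_Ioc)]
        exact htanti.pairwise_disjoint_on_Ioc_succ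
    _ ≤ _ := by
        gcongr
        apply lintegral_mono_set
        refine Set.iUnion_subset fun k t ht' => ?_
        exact lt_of_le_of_lt (Real.rpow_nonneg (T.dF_nonneg hq F f _) _) ht'.1

end HomTree

open scoped ENNReal NNReal
open MeasureTheory Filter
open HomTree

/-- Auxiliary weight. -/
noncomputable def eta (ε β u : ℝ) : ℝ := min (u ^ ε) (u ^ β)

lemma eta_nonneg (ε β u : ℝ) (hu : 0 ≤ u) : 0 ≤ eta ε β u :=
  le_min (Real.rpow_nonneg hu _) (Real.rpow_nonneg hu _)

lemma eta_mono (ε β u v : ℝ) (hε : 0 < ε) (hβ : 0 < β) (hu : 0 ≤ u) (huv : u ≤ v) :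
    eta ε β u ≤ eta ε β v :=
  min_le_min (Real.rpow_le_rpow hu huv hε.le) (Real.rpow_le_rpow hu huv hβ.le)

lemma eta_geom (ε β u : ℝ) (j : ℕ) (hε : 0 < ε) (hεβ : ε ≤ β) (hu : 0 < u) (h : (2:ℝ) ^ j < 2 * u) :
    1 ≤ 2 ^ β * eta ε β u * ((2:ℝ) ^ (-ε)) ^ j := by
  have h2j : (0:ℝ) < 2 ^ j := by positivity
  have h1 : 1 ≤ 2 * u / 2 ^ j := by rw [one_le_div h2j]; exact h.le
  have e1 : ∀ a : ℝ, (2 * u / 2 ^ j) ^ a = 2 ^ a * u ^ a * ((2:ℝ) ^ (-a)) ^ j := by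
    intro a
    rw [Real.div_rpow (by positivity) h2j.le, Real.mul_rpow (by norm_num) hu.le, div_eq_mul_inv]
    congr 1
    rw [← Real.rpow_neg h2j.le, ← Real.rpow_natCast, ← Real.rpow_natCast,
      ← Real.rpow_mul (by norm_num), ← Real.rpow_mul (by norm_num), mul_comm]
  unfold eta
  rcases min_choice (u ^ ε) (u ^ β) with hm | hm
  · rw [hm]
    have := Real.one_le_rpow h1 hε.le
    rw [e1] at this
    refine this.trans ?_
    gcongr
    norm_num
  · rw [hm]
    have := Real.one_le_rpow h1 (hε.le.trans hεβ)
    rw [e1] at this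
    refine this.trans ?_
    gcongr
    norm_num

namespace HomTree
variable {q : ℕ}

/-- The averaged truncation functional. -/
noncomputable def Phi (T : HomTree q) (ε β : ℝ) (f : T.V → ℂ) (lam : ℝ) : ℝ≥0∞ :=
  ∑' x, ENNReal.ofReal (‖f x‖ * T.w x * eta ε β (‖f x‖ / lam))

lemma hh_sum (T : HomTree q) (hq : 2 ≤ q) (ε β : ℝ) (hε : 0 < ε) (hεβ : ε ≤ β) (f : T.V → ℂ)
    (lam : ℝ) (hl : 0 < lam) (x : T.V) :
    ∑' j : ℕ, ENNReal.ofReal (T.hh f (lam * 2 ^ j) x) ≤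
      ENNReal.ofReal (2 ^ β * (1 - (2:ℝ) ^ (-ε))⁻¹) *
        ENNReal.ofReal (‖f x‖ * T.w x * eta ε β (‖f x‖ / lam)) := by
  have hw := T.w_pos hq x
  set r : ℝ := (2:ℝ) ^ (-ε) with hr
  have hr0 : 0 < r := by positivity
  have hr1 : r < 1 := Real.rpow_lt_one_of_one_lt_of_neg (by norm_num) (by linarith)
  set N := ‖f x‖ with hN
  have hN0 : 0 ≤ N := norm_nonneg _
  have hη := eta_nonneg ε β (N / lam) (by positivity)
  set B := 2 ^ β * (N * T.w x * eta ε β (N / lam)) with hB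
  have hB0 : 0 ≤ B := by positivity
  calc ∑' j : ℕ, ENNReal.ofReal (T.hh f (lam * 2 ^ j) x) ≤ ∑' j : ℕ, ENNReal.ofReal (B * r ^ j) := by
        apply ENNReal.tsum_le_tsum
        intro j
        apply ENNReal.ofReal_le_ofReal
        unfold hh
        split_ifs with h
        · have hNpos : 0 < N := lt_of_le_of_lt (by positivity) h
          have := eta_geom ε β (N / lam) j hε hεβ (by positivity)
            (by rw [← mul_div_assoc, lt_div_iff₀ hl]; linarith)
          calc N * T.w x = N * T.w x * 1 := by ring
            _ ≤ N * T.w x * (2 ^ β * eta ε β (N / lam) * r ^ j) := by gcongr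
            _ = _ := by rw [hB]; ring
        · positivity
    _ = ENNReal.ofReal (B * (1 - r)⁻¹) := by
        rw [← ENNReal.ofReal_tsum_of_nonneg (fun j => by positivity)
          ((summable_geometric_of_lt_one hr0.le hr1).mul_left B), tsum_mul_left,
          tsum_geometric_of_lt_one hr0.le hr1]
    _ = _ := by
        have : 0 < 1 - r := by linarith
        rw [← ENNReal.ofReal_mul (by positivity)]
        congr 1; rw [hB]; ring

open Classical in
lemma good (T : HomTree q) (hq : 2 ≤ q) (p κ ε β C1 c : ℝ) (p₁ : ℝ≥0∞) (hp : 1 < p)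
    (hp₁ : 1 < p₁) (hκ : κ = (p₁.toReal)⁻¹) (hε : 0 < ε) (hεβ : ε ≤ β)
    (hβ : p₁ ≠ ⊤ → β = p₁.toReal - 1)
    (hC1 : C1 = 2 ^ β * (1 - (2:ℝ) ^ (-ε))⁻¹)
    (hc : c = 48 * q * C1 + (2 * (q:ℝ) ^ p₁.toReal * C1 + 1) + q)
    (f : T.V → ℂ) (hf : T.lpPow f p ≠ ⊤) (lam φ : ℝ) (hl : 0 < lam) (hφ : 0 ≤ φ)
    (hΦ : T.Phi ε β f lam = ENNReal.ofReal φ) :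
    ∃ g : T.V → ℂ, T.H1Norm (fun x => f x - g x) ≤ ENNReal.ofReal (c * φ) ∧
      T.lpNormE p₁ g ≤ ENNReal.ofReal (c * (lam * (φ / lam) ^ κ)) := by
  have hr1 : (2:ℝ) ^ (-ε) < 1 := Real.rpow_lt_one_of_one_lt_of_neg (by norm_num) (by linarith)
  have hC10 : 0 ≤ C1 := by
    have : 0 < 1 - (2:ℝ) ^ (-ε) := by linarith
    rw [hC1]; positivity
  obtain ⟨g, E, hg1, hg2, hg3, hg4⟩ := T.cz hq p hp f hf lam hl
  have hsum : ∑' j : ℕ, ∑' x, ENNReal.ofReal (T.hh f (lam * 2 ^ j) x) ≤ ENNReal.ofReal (C1 * φ) := by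
    rw [ENNReal.tsum_comm, ENNReal.ofReal_mul hC10, ← hΦ]
    unfold Phi
    rw [← ENNReal.tsum_mul_left]
    apply ENNReal.tsum_le_tsum
    intro x
    rw [hC1]
    exact T.hh_sum hq ε β hε hεβ f lam hl x
  have hsum0 : ∑' x, ENNReal.ofReal (T.hh f lam x) ≤ ENNReal.ofReal (C1 * φ) := by
    refine le_trans ?_ hsum
    have := ENNReal.le_tsum (f := fun j : ℕ => ∑' x, ENNReal.ofReal (T.hh f (lam * 2 ^ j) x)) 0
    simpa using this
  refine ⟨g, ?_, ?_⟩
  · refine hg4.trans ((mul_le_mul_right hsum _).trans ?_)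
    rw [← ENNReal.ofReal_mul (by positivity)]
    apply ENNReal.ofReal_le_ofReal
    rw [← mul_assoc]
    gcongr
    rw [hc]
    have : 0 ≤ 2 * (q:ℝ) ^ p₁.toReal * C1 + 1 + q := by positivity
    linarith
  · have hcq : (q:ℝ) ≤ c := by
      rw [hc]
      have : 0 ≤ 48 * q * C1 + (2 * (q:ℝ) ^ p₁.toReal * C1 + 1) := by positivity
      linarith
    unfold lpNormE
    split_ifs with htop
    · have hκz : κ = 0 := by simp [hκ, htop]
      rw [hκz, Real.rpow_zero, mul_one]
      refine iSup_le fun x => ?_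
      rw [nnn]
      apply ENNReal.ofReal_le_ofReal
      refine (hg1 x).trans ?_
      gcongr
    · specialize hβ htop
      set r := p₁.toReal with hr
      have hr1 : 1 < r := by
        have := (ENNReal.toReal_lt_toReal ENNReal.one_ne_top htop).2 hp₁
        simpa using this
      have hr0 : 0 < r := by linarith
      set A := 2 * (q:ℝ) ^ r * C1 + 1 with hA
      have hA1 : 1 ≤ A := by
        have : 0 ≤ 2 * (q:ℝ) ^ r * C1 := by positivity
        linarith
      have hAc : A ≤ c := by
        rw [hc]
        have : 0 ≤ 48 * q * C1 + q := by positivity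
        linarith
      have hpow : T.lpPow g r ≤ ENNReal.ofReal (A * (lam ^ (r - 1) * φ)) := by
        rw [T.lpPow_eq hq g r hr0.le]
        calc ∑' x, ENNReal.ofReal (‖g x‖ ^ r * T.w x)
            ≤ ∑' x, (ENNReal.ofReal ((q:ℝ) ^ r * lam ^ (r - 1)) *
                (if x ∈ E then ENNReal.ofReal (lam * T.w x) else 0) +
              ENNReal.ofReal (lam ^ (r - 1)) *
                ENNReal.ofReal (‖f x‖ * T.w x * eta ε β (‖f x‖ / lam))) := by
              apply ENNReal.tsum_le_tsum
              intro x
              have hw := T.w_pos hq x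
              by_cases hx : x ∈ E
              · rw [if_pos hx]
                refine le_trans ?_ le_self_add
                rw [← ENNReal.ofReal_mul (by positivity)]
                apply ENNReal.ofReal_le_ofReal
                calc ‖g x‖ ^ r * T.w x ≤ (q * lam) ^ r * T.w x := by
                      gcongr; exact hg1 x
                  _ = _ := by
                      rw [Real.mul_rpow (by positivity) hl.le, Real.rpow_sub hl, Real.rpow_one]
                      field_simp
              · rw [if_neg hx, mul_zero, zero_add]
                obtain ⟨h1, h2⟩ := hg2 x hx
                rw [h1, ← ENNReal.ofReal_mul (by positivity)]
                apply ENNReal.ofReal_le_ofReal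
                set N := ‖f x‖ with hN
                rcases eq_or_lt_of_le (norm_nonneg (f x)) with h0 | h0
                · rw [← hN] at h0
                  rw [← h0, Real.zero_rpow hr0.ne']; simp
                · rw [← hN] at h0
                  have hu1 : N / lam ≤ 1 := by rw [div_le_one hl]; exact h2
                  have hη : eta ε β (N / lam) = (N / lam) ^ (r - 1) := by
                    unfold eta
                    rw [min_eq_right, hβ]
                    exact Real.rpow_le_rpow_of_exponent_ge (by positivity) hu1 hεβ
                  rw [hη, Real.div_rpow h0.le hl.le]
                  apply le_of_eq
                  rw [Real.rpow_sub h0, Real.rpow_one]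
                  have := Real.rpow_pos_of_pos hl (r - 1)
                  field_simp
          _ = ENNReal.ofReal ((q:ℝ) ^ r * lam ^ (r - 1)) * (∑' x, if x ∈ E then ENNReal.ofReal (lam * T.w x) else 0)
              + ENNReal.ofReal (lam ^ (r - 1)) * ENNReal.ofReal φ := by
              rw [ENNReal.tsum_add, ENNReal.tsum_mul_left, ENNReal.tsum_mul_left, ← hΦ]
              rfl
          _ ≤ ENNReal.ofReal ((q:ℝ) ^ r * lam ^ (r - 1)) * (2 * ENNReal.ofReal (C1 * φ))
              + ENNReal.ofReal (lam ^ (r - 1)) * ENNReal.ofReal φ := by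
              gcongr
              exact hg3.trans (mul_le_mul_right hsum0 _)
          _ = _ := by
              have e2 : (2:ℝ≥0∞) = ENNReal.ofReal 2 := by simp
              rw [e2, ← ENNReal.ofReal_mul (by positivity), ← ENNReal.ofReal_mul (by positivity),
                ← ENNReal.ofReal_mul (by positivity), ← ENNReal.ofReal_add (by positivity) (by positivity)]
              congr 1; rw [hA]; ring
      refine le_trans (ENNReal.rpow_le_rpow hpow (by positivity)) ?_
      rw [ENNReal.ofReal_rpow_of_nonneg (by positivity) (by positivity)]
      apply ENNReal.ofReal_le_ofReal
      rw [← hκ, Real.mul_rpow (by positivity) (by positivity)]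
      have hκ0 : 0 < κ := by rw [hκ]; positivity
      have hκ1 : κ ≤ 1 := by rw [hκ]; exact inv_le_one_of_one_le₀ hr1.le
      have e1 : (lam ^ (r - 1) * φ) ^ κ = lam * (φ / lam) ^ κ := by
        have : lam ^ (r - 1) * φ = lam ^ r * (φ / lam) := by
          rw [Real.rpow_sub hl, Real.rpow_one]; ring
        rw [this, Real.mul_rpow (by positivity) (by positivity), ← Real.rpow_mul hl.le, hκ,
          mul_inv_cancel₀ hr0.ne', Real.rpow_one]
      rw [e1]
      gcongr
      calc A ^ κ ≤ A ^ (1:ℝ) := Real.rpow_le_rpow_of_exponent_le hA1 hκ1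
        _ = A := Real.rpow_one _
        _ ≤ c := hAc

lemma K_upper (T : HomTree q) (hq : 2 ≤ q) (p κ ε β C1 c : ℝ) (p₁ : ℝ≥0∞) (hp : 1 < p)
    (hp₁ : 1 < p₁) (hκ : κ = (p₁.toReal)⁻¹) (hκ0 : 0 ≤ κ) (hκ1 : κ < 1) (hε : 0 < ε) (hεβ : ε ≤ β)
    (hβ : p₁ ≠ ⊤ → β = p₁.toReal - 1)
    (hC1 : C1 = 2 ^ β * (1 - (2:ℝ) ^ (-ε))⁻¹)
    (hc : c = 48 * q * C1 + (2 * (q:ℝ) ^ p₁.toReal * C1 + 1) + q) (hc0 : 0 ≤ c)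
    (f : T.V → ℂ) (hf : T.lpPow f p ≠ ⊤) (lam φ t : ℝ) (hl : 0 < lam) (hφ : 0 < φ) (ht : 0 < t)
    (hΦ : T.Phi ε β f lam = ENNReal.ofReal φ) (htx : (φ / lam) ^ (1 - κ) ≤ t) :
    T.KH1Lp p₁ (ENNReal.ofReal t) f ≤ ENNReal.ofReal (2 * c * (lam * (φ / lam) ^ κ) * t) := by
  obtain ⟨g, h1, h2⟩ := T.good hq p κ ε β C1 c p₁ hp hp₁ hκ hε hεβ hβ hC1 hc f hf lam φ hl hφ.le hΦ
  unfold KH1Lp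
  refine (iInf_le_of_le (fun x => f x - g x) (iInf_le_of_le g (iInf_le_of_le (fun x => by ring) ?_)))
  refine (add_le_add h1 (mul_le_mul_right h2 _)).trans ?_
  rw [← ENNReal.ofReal_mul ht.le, ← ENNReal.ofReal_add (by positivity) (by positivity)]
  apply ENNReal.ofReal_le_ofReal
  have hx : 0 < φ / lam := by positivity
  have : φ ≤ lam * (φ / lam) ^ κ * t := by
    calc φ = lam * ((φ / lam) ^ κ * (φ / lam) ^ (1 - κ)) := by
          rw [← Real.rpow_add hx]; simp; field_simp
      _ ≤ lam * ((φ / lam) ^ κ * t) := by gcongr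
      _ = _ := by ring
  have := mul_le_mul_of_nonneg_left this hc0
  linarith

end HomTree

open scoped ENNReal NNReal
open MeasureTheory Filter
open HomTree

lemma summable_geom_int (ρ : ℝ) (h0 : 0 ≤ ρ) (h1 : ρ < 1) :
    Summable (fun n : ℤ => ρ ^ n.natAbs) := by
  apply Summable.of_nat_of_neg
  · simpa using summable_geometric_of_lt_one h0 h1
  · simpa using summable_geometric_of_lt_one h0 h1

lemma eta_decay (ε β σ δ a : ℝ) (m k : ℤ) (hδ : 0 < δ) (hδ1 : δ ≤ σ - ε)
    (hδ2 : δ ≤ β - σ) (ha : 0 < a) (hm1 : (2:ℝ) ^ m ≤ a) (hm2 : a < (2:ℝ) ^ (m + 1)) :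
    ((2:ℝ) ^ k) ^ σ * eta ε β (a / 2 ^ k) ≤ a ^ σ * (2 ^ δ * ((2:ℝ) ^ (-δ)) ^ (k - m).natAbs) := by
  have h2k : (0:ℝ) < 2 ^ k := by positivity
  set u := a / 2 ^ k with hu
  have hu0 : 0 < u := by positivity
  have e0 : ((2:ℝ) ^ k) ^ σ = a ^ σ * u ^ (-σ) := by
    rw [hu, Real.rpow_neg (by positivity), Real.div_rpow ha.le h2k.le]
    have := Real.rpow_pos_of_pos ha σ
    have := Real.rpow_pos_of_pos h2k σ
    field_simp
  rw [e0, mul_assoc]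
  refine mul_le_mul_of_nonneg_left ?_ (by positivity)
  have e3 : ∀ n : ℕ, ((2:ℝ) ^ (-δ)) ^ n = ((2:ℝ) ^ (n:ℤ)) ^ (-δ) := by
    intro n
    rw [zpow_natCast, ← Real.rpow_natCast, ← Real.rpow_natCast, ← Real.rpow_mul (by norm_num),
      ← Real.rpow_mul (by norm_num), mul_comm]
  rw [e3]
  rcases le_or_gt k m with hkm | hkm
  · have hn : ((k - m).natAbs : ℤ) = m - k := by omega
    have hlow : (2:ℝ) ^ (m - k) ≤ u := by
      rw [hu, zpow_sub₀ (by norm_num)]; gcongr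
    have h1 : (1:ℝ) ≤ 2 ^ (m - k) := one_le_zpow₀ (by norm_num) (by omega)
    rw [hn]
    calc u ^ (-σ) * eta ε β u ≤ u ^ (-σ) * u ^ ε := by gcongr; exact min_le_left _ _
      _ = u ^ (-σ + ε) := by rw [Real.rpow_add hu0]
      _ ≤ u ^ (-δ) := Real.rpow_le_rpow_of_exponent_le (h1.trans hlow) (by linarith)
      _ ≤ ((2:ℝ) ^ (m - k)) ^ (-δ) := Real.rpow_le_rpow_of_nonpos (by positivity) hlow (by linarith)
      _ ≤ _ := by
        have : (1:ℝ) ≤ 2 ^ δ := Real.one_le_rpow (by norm_num) hδ.le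
        have h5 : 0 ≤ ((2:ℝ) ^ (m - k)) ^ (-δ) := by positivity
        exact le_mul_of_one_le_left h5 this
  · have hn : ((k - m).natAbs : ℤ) = k - m := by omega
    have hup : u ≤ (2:ℝ) ^ (m + 1 - k) := by
      rw [hu, zpow_sub₀ (by norm_num)]; gcongr
    have h1 : (2:ℝ) ^ (m + 1 - k) ≤ 1 := zpow_le_one_of_nonpos₀ (by norm_num) (by omega)
    rw [hn]
    calc u ^ (-σ) * eta ε β u ≤ u ^ (-σ) * u ^ β := by gcongr; exact min_le_right _ _
      _ = u ^ (-σ + β) := by rw [Real.rpow_add hu0]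
      _ ≤ u ^ δ := Real.rpow_le_rpow_of_exponent_ge hu0 (hup.trans h1) (by linarith)
      _ ≤ ((2:ℝ) ^ (m + 1 - k)) ^ δ := by gcongr
      _ = _ := by
        have : (2:ℝ) ^ (m + 1 - k) = 2 * ((2:ℝ) ^ (k - m))⁻¹ := by
          rw [← zpow_neg, ← zpow_one_add₀ (by norm_num)]; congr 1; ring
        rw [this, Real.mul_rpow (by norm_num) (by positivity), Real.inv_rpow (by positivity),
          Real.rpow_neg (by positivity)]

namespace HomTree
variable {q : ℕ}

lemma Phi_sum (T : HomTree q) (hq : 2 ≤ q) (p ε β δ C3 : ℝ) (hp : 1 < p) (hδ : 0 < δ)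
    (hδ1 : δ ≤ (p - 1) - ε) (hδ2 : δ ≤ β - (p - 1))
    (hC3 : C3 = 2 ^ δ * ∑' n : ℤ, ((2:ℝ) ^ (-δ)) ^ n.natAbs) (f : T.V → ℂ) :
    ∑' k : ℤ, ENNReal.ofReal (((2:ℝ) ^ k) ^ (p - 1)) * T.Phi ε β f (2 ^ k) ≤
      ENNReal.ofReal C3 * T.lpPow f p := by
  have hρ1 : (2:ℝ) ^ (-δ) < 1 := Real.rpow_lt_one_of_one_lt_of_neg (by norm_num) (by linarith)
  have hsm := summable_geom_int ((2:ℝ) ^ (-δ)) (by positivity) hρ1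
  have hS0 : 0 ≤ ∑' n : ℤ, ((2:ℝ) ^ (-δ)) ^ n.natAbs := tsum_nonneg fun n => by positivity
  have hC30 : 0 ≤ C3 := by rw [hC3]; positivity
  rw [T.lpPow_eq hq f p (by linarith)]
  unfold Phi
  simp_rw [← ENNReal.tsum_mul_left]
  rw [ENNReal.tsum_comm]
  apply ENNReal.tsum_le_tsum
  intro x
  have hw := T.w_pos hq x
  rcases eq_or_lt_of_le (norm_nonneg (f x)) with h | h
  · rw [← h]; simp
  · set a := ‖f x‖ with hadef
    obtain ⟨m, hm1, hm2⟩ := exists_mem_Ico_zpow h (by norm_num : (1:ℝ) < 2)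
    have hB : 0 ≤ a * T.w x * a ^ (p - 1) * 2 ^ δ := by positivity
    calc ∑' k : ℤ, ENNReal.ofReal (((2:ℝ) ^ k) ^ (p - 1)) * ENNReal.ofReal (a * T.w x * eta ε β (a / 2 ^ k))
        ≤ ∑' k : ℤ, ENNReal.ofReal ((a * T.w x * a ^ (p - 1) * 2 ^ δ) * ((2:ℝ) ^ (-δ)) ^ (k - m).natAbs) := by
          apply ENNReal.tsum_le_tsum
          intro k
          rw [← ENNReal.ofReal_mul (by positivity)]
          apply ENNReal.ofReal_le_ofReal
          have := eta_decay ε β (p - 1) δ a m k hδ hδ1 hδ2 h hm1 hm2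
          calc ((2:ℝ) ^ k) ^ (p - 1) * (a * T.w x * eta ε β (a / 2 ^ k))
              = a * T.w x * (((2:ℝ) ^ k) ^ (p - 1) * eta ε β (a / 2 ^ k)) := by ring
            _ ≤ a * T.w x * (a ^ (p - 1) * (2 ^ δ * ((2:ℝ) ^ (-δ)) ^ (k - m).natAbs)) := by gcongr
            _ = _ := by ring
      _ = ∑' k : ℤ, ENNReal.ofReal ((a * T.w x * a ^ (p - 1) * 2 ^ δ) * ((2:ℝ) ^ (-δ)) ^ k.natAbs) :=
          (Equiv.subRight m).tsum_eq (fun k : ℤ => ENNReal.ofReal ((a * T.w x * a ^ (p - 1) * 2 ^ δ) * ((2:ℝ) ^ (-δ)) ^ k.natAbs))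
      _ = ENNReal.ofReal ((a * T.w x * a ^ (p - 1) * 2 ^ δ) * ∑' k : ℤ, ((2:ℝ) ^ (-δ)) ^ k.natAbs) := by
          rw [← ENNReal.ofReal_tsum_of_nonneg (fun k => by positivity) (hsm.mul_left _), tsum_mul_left]
      _ ≤ _ := by
          rw [← ENNReal.ofReal_mul hC30]
          apply ENNReal.ofReal_le_ofReal
          apply le_of_eq
          rw [hC3, Real.rpow_sub h, Real.rpow_one]
          field_simp

lemma K_zero (T : HomTree q) (p₁ : ℝ≥0∞) (hp₁ : 1 < p₁) (t : ℝ≥0∞) (f : T.V → ℂ) (hf : ∀ x, f x = 0) :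
    T.KH1Lp p₁ t f = 0 := by
  have h1 : T.H1Norm (fun _ => 0) = 0 := by
    have := T.H1Norm_le (ι := Empty) (fun _ => 0) (fun i => i.elim) (fun i => i.elim)
      (fun i => i.elim) (fun x => hasSum_empty)
    simpa using this
  have h2 : T.lpNormE p₁ (fun _ => 0) = 0 := by
    unfold lpNormE
    split_ifs with h
    · simp
    · have hr : 0 < p₁.toReal := ENNReal.toReal_pos (by rintro rfl; simp at hp₁) h
      unfold lpPow
      simp [hr]
  refine le_antisymm ?_ zero_le
  unfold KH1Lp
  refine (iInf_le_of_le (fun _ => 0) (iInf_le_of_le (fun _ => 0) (iInf_le_of_le (fun x => by simp [hf x]) ?_)))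
  rw [h1, h2]; simp

theorem upper (T : HomTree q) (hq : 2 ≤ q) (p κ θ ε β δ C1 C3 c : ℝ) (p₁ : ℝ≥0∞) (hp : 1 < p)
    (hp₁ : 1 < p₁) (hκ : κ = (p₁.toReal)⁻¹) (hκ0 : 0 ≤ κ) (hκ1 : κ < 1)
    (hθ1 : θ < 1) (hrel : p * (1 - θ) * (1 - κ) = 1 - κ * p)
    (hε : 0 < ε) (hδ : 0 < δ)
    (hδ1 : δ ≤ (p - 1) - ε) (hδ2 : δ ≤ β - (p - 1))
    (hβ : p₁ ≠ ⊤ → β = p₁.toReal - 1)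
    (hC1 : C1 = 2 ^ β * (1 - (2:ℝ) ^ (-ε))⁻¹)
    (hC3 : C3 = 2 ^ δ * ∑' n : ℤ, ((2:ℝ) ^ (-δ)) ^ n.natAbs)
    (hc : c = 48 * q * C1 + (2 * (q:ℝ) ^ p₁.toReal * C1 + 1) + q) (hc0 : 0 < c)
    (f : T.V → ℂ) (hf : T.lpPow f p ≠ ⊤) :
    T.II p₁ θ p f ≤ ENNReal.ofReal ((4 * c) ^ p / (p * (1 - θ))) * (ENNReal.ofReal C3 * T.lpPow f p) := by
  have hp0 : 0 < p := by linarith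
  by_cases hfz : ∀ x, f x = 0
  · unfold II
    have : ∀ t, T.KH1Lp p₁ t f = 0 := fun t => T.K_zero p₁ hp₁ t f hfz
    simp [this, hp0]
  push Not at hfz
  obtain ⟨x₀, hx₀⟩ := hfz
  have hεβ : ε ≤ β := by linarith
  have hβ0 : 0 < β := by linarith
  have hsum := T.Phi_sum hq p ε β δ C3 hp hδ hδ1 hδ2 hC3 f
  set M : ℝ≥0∞ := ENNReal.ofReal C3 * T.lpPow f p with hM
  have hMt : M ≠ ⊤ := ENNReal.mul_ne_top ENNReal.ofReal_ne_top hf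
  have hterm : ∀ k : ℤ, ENNReal.ofReal (((2:ℝ) ^ k) ^ (p - 1)) * T.Phi ε β f (2 ^ k) ≤ M :=
    fun k => (ENNReal.le_tsum k).trans hsum
  have hfin : ∀ k : ℤ, T.Phi ε β f (2 ^ k) ≠ ⊤ := by
    intro k h
    have h1 := hterm k
    rw [h, ENNReal.mul_top (by simp only [ne_eq, ENNReal.ofReal_eq_zero, not_le]; positivity)] at h1
    exact hMt (top_le_iff.1 h1)
  set φ : ℤ → ℝ := fun k => (T.Phi ε β f (2 ^ k)).toReal with hφ
  have hΦ : ∀ k : ℤ, T.Phi ε β f (2 ^ k) = ENNReal.ofReal (φ k) :=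
    fun k => (ENNReal.ofReal_toReal (hfin k)).symm
  have hφpos : ∀ k, 0 < φ k := by
    intro k
    apply ENNReal.toReal_pos _ (hfin k)
    intro h
    unfold Phi at h
    rw [ENNReal.tsum_eq_zero] at h
    have h1 := h x₀
    rw [ENNReal.ofReal_eq_zero] at h1
    have hn : 0 < ‖f x₀‖ := norm_pos_iff.2 hx₀
    have hw := T.w_pos hq x₀
    have : 0 < eta ε β (‖f x₀‖ / 2 ^ k) := lt_min (by positivity) (by positivity)
    have : 0 < ‖f x₀‖ * T.w x₀ * eta ε β (‖f x₀‖ / 2 ^ k) := by positivity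
    linarith
  have hφanti : Antitone φ := by
    intro a b hab
    apply ENNReal.toReal_mono (hfin a)
    unfold Phi
    apply ENNReal.tsum_le_tsum
    intro x
    apply ENNReal.ofReal_le_ofReal
    have hw := T.w_pos hq x
    have h2 : (2:ℝ) ^ a ≤ 2 ^ b := zpow_le_zpow_right₀ (by norm_num) hab
    have := eta_mono ε β (‖f x‖ / 2 ^ b) (‖f x‖ / 2 ^ a) hε hβ0 (by positivity) (by gcongr)
    gcongr
  have hφM : ∀ k : ℤ, ((2:ℝ) ^ k) ^ (p - 1) * φ k ≤ M.toReal := by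
    intro k
    have h1 := hterm k
    rw [hΦ k, ← ENNReal.ofReal_mul (by positivity)] at h1
    exact (ENNReal.ofReal_le_iff_le_toReal hMt).1 h1
  set X : ℤ → ℝ := fun k => φ k / 2 ^ k with hX
  have hXpos : ∀ k, 0 < X k := fun k => div_pos (hφpos k) (by positivity)
  have hXs : ∀ k, X (k + 1) ≤ X k := by
    intro k
    simp only [hX]
    have h1 := hφanti (show k ≤ k + 1 by omega)
    have h2 : (2:ℝ) ^ k ≤ 2 ^ (k + 1) := zpow_le_zpow_right₀ (by norm_num) (by omega)
    have := (hφpos k).le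
    gcongr
  -- selection of the dyadic level
  have hsel : ∀ τ : ℝ, 0 < τ → ∃ k : ℤ, τ < X k ∧ X (k + 1) ≤ τ := by
    intro τ hτ
    obtain ⟨k, hk1, hk2⟩ := Int.exists_greatest_of_bdd (P := fun k : ℤ => τ < X k) (by
      obtain ⟨n, hn⟩ := pow_unbounded_of_one_lt (M.toReal / τ) (by norm_num : (1:ℝ) < 2)
      refine ⟨n, fun z hz => ?_⟩
      by_contra! hzn
      have h2n : (2:ℝ) ^ n ≤ 2 ^ z := by
        rw [← zpow_natCast]; exact zpow_le_zpow_right₀ (by norm_num) hzn.le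
      have h1 : (1:ℝ) ≤ (2 ^ z) ^ (p - 1) :=
        Real.one_le_rpow (le_trans (one_le_pow₀ (by norm_num)) h2n) (by linarith)
      have h3 := hφM z
      have h4 : φ z ≤ M.toReal := le_trans (le_mul_of_one_le_left (hφpos z).le h1) h3
      rw [div_lt_iff₀ hτ] at hn
      simp only [hX] at hz
      rw [lt_div_iff₀ (by positivity)] at hz
      nlinarith) (by
      obtain ⟨n, hn⟩ := pow_unbounded_of_one_lt (τ / φ 0) (by norm_num : (1:ℝ) < 2)
      refine ⟨-(n:ℤ), ?_⟩
      simp only [hX]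
      have h1 := hφanti (show -(n:ℤ) ≤ 0 by omega)
      rw [zpow_neg, zpow_natCast, div_inv_eq_mul]
      rw [div_lt_iff₀ (hφpos 0)] at hn
      have : (0:ℝ) < 2 ^ n := by positivity
      nlinarith)
    refine ⟨k, hk1, ?_⟩
    by_contra! h
    have := hk2 _ h
    omega
  have hs : 0 < p * (1 - θ) := mul_pos hp0 (by linarith)
  set s := p * (1 - θ) with hsdef
  set Z : ℤ → ℝ := fun k => (4 * c * ((2:ℝ) ^ k * X k ^ κ)) ^ p with hZ
  have hZ0 : ∀ k, 0 ≤ Z k := fun k => by have := hXpos k; simp only [hZ]; positivity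
  have hpt : ∀ t ∈ Set.Ioi (0:ℝ),
      (T.KH1Lp p₁ (ENNReal.ofReal t) f / (ENNReal.ofReal t) ^ θ) ^ p * (ENNReal.ofReal t)⁻¹ ≤
      ∑' k : ℤ, (Set.Ioc 0 (X k ^ (1 - κ))).indicator
        (fun t => ENNReal.ofReal (Z k) * ENNReal.ofReal (t ^ (s - 1))) t := by
    intro t ht
    have ht0 : 0 < t := ht
    have hτ : (t ^ (1 - κ)⁻¹) ^ (1 - κ) = t := Real.rpow_inv_rpow ht0.le (by linarith)
    obtain ⟨k, hk1, hk2⟩ := hsel (t ^ (1 - κ)⁻¹) (by positivity)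
    have hk1' : t ≤ X k ^ (1 - κ) := by
      rw [← hτ]; exact Real.rpow_le_rpow (by positivity) hk1.le (by linarith)
    have hk2' : X (k + 1) ^ (1 - κ) ≤ t := by
      conv_rhs => rw [← hτ]
      exact Real.rpow_le_rpow (hXpos _).le hk2 (by linarith)
    refine le_trans ?_ (ENNReal.le_tsum k)
    have hmem : t ∈ Set.Ioc 0 (X k ^ (1 - κ)) := ⟨ht0, hk1'⟩
    rw [Set.indicator_of_mem hmem,
      ← ENNReal.ofReal_mul (hZ0 k)]
    have hXk := hXpos k
    have hXk1 := hXpos (k + 1)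
    rw [hsdef, ← integrand_eq _ t θ p (by positivity) ht0 hp0]
    gcongr
    refine (T.K_upper hq p κ ε β C1 c p₁ hp hp₁ hκ hκ0 hκ1 hε hεβ hβ hC1 hc hc0.le f hf
      (2 ^ (k + 1)) (φ (k + 1)) t (by positivity) (hφpos _) ht0 (hΦ _) hk2').trans ?_
    apply ENNReal.ofReal_le_ofReal
    change 2 * c * (2 ^ (k + 1) * X (k + 1) ^ κ) * t ≤ _
    have h1 : X (k + 1) ^ κ ≤ X k ^ κ := Real.rpow_le_rpow hXk1.le (hXs k) hκ0
    calc 2 * c * (2 ^ (k + 1) * X (k + 1) ^ κ) * t ≤ 2 * c * (2 ^ (k + 1) * X k ^ κ) * t := by gcongr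
      _ = _ := by rw [zpow_add_one₀ (by norm_num)]; ring
  calc T.II p₁ θ p f ≤ ∫⁻ t in Set.Ioi (0:ℝ), ∑' k : ℤ, (Set.Ioc 0 (X k ^ (1 - κ))).indicator
        (fun t => ENNReal.ofReal (Z k) * ENNReal.ofReal (t ^ (s - 1))) t :=
        setLIntegral_mono' measurableSet_Ioi hpt
    _ = ∑' k : ℤ, ∫⁻ t in Set.Ioi (0:ℝ), (Set.Ioc 0 (X k ^ (1 - κ))).indicator
        (fun t => ENNReal.ofReal (Z k) * ENNReal.ofReal (t ^ (s - 1))) t := by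
        apply lintegral_tsum
        intro k
        apply Measurable.aemeasurable
        apply Measurable.indicator _ measurableSet_Ioc
        fun_prop
    _ = ∑' k : ℤ, ENNReal.ofReal ((4 * c) ^ p / s) *
          (ENNReal.ofReal (((2:ℝ) ^ k) ^ (p - 1)) * T.Phi ε β f (2 ^ k)) := by
        congr 1; funext k
        have hXk := hXpos k
        have hss : Set.Ioc 0 (X k ^ (1 - κ)) ⊆ Set.Ioi 0 := fun t ht => ht.1
        rw [setLIntegral_indicator measurableSet_Ioc, Set.inter_eq_left.2 hss,
          lintegral_const_mul _ (by fun_prop), lint_pow s 0 _ hs le_rfl (by positivity), hΦ k,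
          ← ENNReal.ofReal_mul (hZ0 k), ← ENNReal.ofReal_mul (by positivity),
          ← ENNReal.ofReal_mul (by positivity)]
        congr 1
        have e1 : (X k ^ (1 - κ)) ^ s = X k ^ (1 - κ * p) := by
          rw [← Real.rpow_mul hXk.le, mul_comm, hrel]
        have e2 : Z k = (4 * c) ^ p * (((2:ℝ) ^ k) ^ p * X k ^ (κ * p)) := by
          simp only [hZ]
          rw [Real.mul_rpow (x := 4 * c) (by positivity) (by positivity),
            Real.mul_rpow (x := (2:ℝ) ^ k) (by positivity) (by positivity), ← Real.rpow_mul hXk.le]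
        have e3 : X k ^ (κ * p) * X k ^ (1 - κ * p) = X k := by
          rw [← Real.rpow_add hXk]; simp
        have e4 : ((2:ℝ) ^ k) ^ p * X k = ((2:ℝ) ^ k) ^ (p - 1) * φ k := by
          rw [Real.rpow_sub (by positivity), Real.rpow_one]; simp only [hX]; ring
        rw [e1, e2, Real.zero_rpow hs.ne', sub_zero, ← e4]
        calc (4 * c) ^ p * (((2:ℝ) ^ k) ^ p * X k ^ (κ * p)) * (X k ^ (1 - κ * p) / s)
            = (4 * c) ^ p / s * (((2:ℝ) ^ k) ^ p * (X k ^ (κ * p) * X k ^ (1 - κ * p))) := by ring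
          _ = _ := by rw [e3]
    _ ≤ _ := by
        rw [ENNReal.tsum_mul_left]
        gcongr

end HomTree

open scoped ENNReal NNReal
open MeasureTheory Filter
open HomTree

/-- for `1 < p < p₁ ≤ ∞` and `θ ∈ (0,1)` with `1/p = (1-θ) + θ/p₁`,
the real interpolation space `[H¹(μ), L^{p₁}(μ)]_{θ,p}` equals `L^p(μ)` with
equivalent norms. -/
theorem real_interpolation_H1_Lp {q : ℕ} (hq : 2 ≤ q) (p : ℝ) (p₁ : ℝ≥0∞) (θ : ℝ)
    (hp : 1 < p) (hpp₁ : ENNReal.ofReal p < p₁) (hθ0 : 0 < θ) (hθ1 : θ < 1)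
    (hrel : 1 / p = (1 - θ) + θ * (p₁.toReal)⁻¹) :
    ∃ C : ℝ≥0, 0 < C ∧ ∀ (T : HomTree q) (f : T.V → ℂ),
      T.interpNorm p₁ θ p f ≤ (C : ℝ≥0∞) * T.lpNormE (ENNReal.ofReal p) f ∧
      T.lpNormE (ENNReal.ofReal p) f ≤ (C : ℝ≥0∞) * T.interpNorm p₁ θ p f := by
  have hp0 : 0 < p := by linarith
  set κ := (p₁.toReal)⁻¹ with hκ
  have hp₁ : 1 < p₁ := lt_trans (by simpa using hp) hpp₁
  have hκ0 : 0 ≤ κ := by positivity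
  have hrp : p₁ ≠ ⊤ → p < p₁.toReal := fun h =>
    (ENNReal.ofReal_lt_iff_lt_toReal hp0.le h).1 hpp₁
  have hκp : κ * p < 1 := by
    by_cases h : p₁ = ⊤
    · simp [hκ, h]
    · have := hrp h
      rw [hκ, inv_mul_lt_iff₀ (by linarith)]; linarith
  have hκ1 : κ < 1 := by nlinarith
  have hrel' : p * (1 - θ) * (1 - κ) = 1 - κ * p := by
    field_simp at hrel
    linarith
  -- parameters
  obtain ⟨β, hβ, hβp⟩ : ∃ β : ℝ, (p₁ ≠ ⊤ → β = p₁.toReal - 1) ∧ p - 1 < β := by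
    by_cases h : p₁ = ⊤
    · exact ⟨p, fun h' => absurd h h', by linarith⟩
    · exact ⟨p₁.toReal - 1, fun _ => rfl, by have := hrp h; linarith⟩
  obtain ⟨δ, hδ, hδ1, hδ2⟩ : ∃ δ : ℝ, 0 < δ ∧ δ ≤ (p - 1) - (p - 1) / 2 ∧ δ ≤ β - (p - 1) :=
    ⟨min ((p - 1) - (p - 1) / 2) (β - (p - 1)), lt_min (by linarith) (by linarith),
      min_le_left _ _, min_le_right _ _⟩
  set ε := (p - 1) / 2 with hε
  have hε0 : 0 < ε := by linarith
  obtain ⟨C1, hC1⟩ : ∃ C1 : ℝ, C1 = 2 ^ β * (1 - (2:ℝ) ^ (-ε))⁻¹ := ⟨_, rfl⟩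
  obtain ⟨C3, hC3⟩ : ∃ C3 : ℝ, C3 = 2 ^ δ * ∑' n : ℤ, ((2:ℝ) ^ (-δ)) ^ n.natAbs := ⟨_, rfl⟩
  obtain ⟨c, hc⟩ : ∃ c : ℝ, c = 48 * q * C1 + (2 * (q:ℝ) ^ p₁.toReal * C1 + 1) + q := ⟨_, rfl⟩
  have hr1 : (2:ℝ) ^ (-ε) < 1 := Real.rpow_lt_one_of_one_lt_of_neg (by norm_num) (by linarith)
  have hC10 : 0 ≤ C1 := by
    have : 0 < 1 - (2:ℝ) ^ (-ε) := by linarith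
    rw [hC1]; positivity
  have hc0 : 0 < c := by rw [hc]; positivity
  obtain ⟨A, hA⟩ : ∃ A : ℝ≥0∞, A = ENNReal.ofReal ((4 * c) ^ p / (p * (1 - θ))) * ENNReal.ofReal C3 +
    ENNReal.ofReal (2 ^ p * 4 ^ p * (p * (1 - θ)) / (1 - κ * p)) + 1 := ⟨_, rfl⟩
  have hAt : A ≠ ⊤ := by rw [hA]; finiteness
  have hA1 : 1 ≤ A := by rw [hA]; exact le_add_self
  have hAp : A ^ (1 / p) ≠ ⊤ := ENNReal.rpow_ne_top_of_nonneg (by positivity) hAt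
  have hAp1 : 1 ≤ A ^ (1 / p) := ENNReal.one_le_rpow hA1 (by positivity)
  have hcoe : ((A ^ (1 / p)).toNNReal : ℝ≥0∞) = A ^ (1 / p) := ENNReal.coe_toNNReal hAp
  refine ⟨(A ^ (1 / p)).toNNReal, ?_, ?_⟩
  · apply ENNReal.toNNReal_pos _ hAp
    intro h; rw [h] at hAp1; simp at hAp1
  · intro T f
    rw [hcoe]
    have hN : T.lpNormE (ENNReal.ofReal p) f = (T.lpPow f p) ^ (1 / p) := by
      unfold lpNormE
      rw [if_neg ENNReal.ofReal_ne_top, ENNReal.toReal_ofReal hp0.le, one_div]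
    have hI : T.interpNorm p₁ θ p f = (T.II p₁ θ p f) ^ (1 / p) := rfl
    rw [hN, hI, ← ENNReal.mul_rpow_of_nonneg _ _ (by positivity),
      ← ENNReal.mul_rpow_of_nonneg _ _ (by positivity)]
    constructor
    · apply ENNReal.rpow_le_rpow _ (by positivity)
      by_cases hf : T.lpPow f p = ⊤
      · rw [hf, ENNReal.mul_top (by intro h; rw [h] at hA1; simp at hA1)]; exact le_top
      · have := T.upper hq p κ θ ε β δ C1 C3 c p₁ hp hp₁ hκ hκ0 hκ1 hθ1 hrel' hε0 hδ hδ1 hδ2 hβ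
          hC1 hC3 hc hc0 f hf
        rw [← mul_assoc] at this
        refine this.trans ?_
        gcongr
        rw [hA, add_assoc]; exact le_self_add
    · apply ENNReal.rpow_le_rpow _ (by positivity)
      refine (T.lower hq p κ θ p₁ hp hp₁ hκ hκ0 hκp hκ1 hθ1 hrel' f).trans ?_
      gcongr
      rw [hA]
      exact le_add_self.trans le_self_add
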